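/- arXiv:2505.16457 — 9 statements merged into one kernel-verified Lean document; each statement's English description precedes it below -/
import Mathlib

section
/- Let X and Y be finite sets, R a nonempty finite set with a probability distribution π on R, V : X × Y × R → ℝ a function with 0 ≤ V(x,y,r) ≤ 1 for all (x,y,r), and ε, δ > 0. Suppose that for every (x,y) ∈ X × Y, E_{r~π}[V(x,y,r)] ≤ ε. Then for every positive integer t satisfying 2·|X|·|Y|·exp(−2δ²t) < 1, there exist r₁, …, r_t ∈ R such that for every (x,y) ∈ X × Y, (1/t)·Σ_{i=1}^t V(x,y,r_i) ≤ ε + δ. -/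
open MeasureTheory ProbabilityTheory in
/-- **Hoeffding's lemma** for a finitely supported distribution given by its weights. -/
theorem sum_mul_exp_le_of_mem_Icc_zero_one {R : Type*} [Fintype R]
    (π : R → ℝ) (hπ : ∀ r, 0 ≤ π r) (hπ1 : ∑ r, π r = 1)
    (v : R → ℝ) (hv : ∀ r, v r ∈ Set.Icc 0 1) (s : ℝ) :
    ∑ r, π r * Real.exp (s * (v r - ∑ q, π q * v q)) ≤ Real.exp (s ^ 2 / 8) := by
  let _ : MeasurableSpace R := ⊤
  let μ : Measure R := ∑ r, ENNReal.ofReal (π r) • Measure.dirac r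
  have : IsProbabilityMeasure μ := ⟨by
    simp [μ, Measure.finsetSum_apply, ← ENNReal.ofReal_sum_of_nonneg, hπ, hπ1]⟩
  have hint (g : R → ℝ) : ∫ r, g r ∂μ = ∑ r, π r * g r := by
    rw [integral_finsetSum_measure fun r _ ↦
      (integrable_dirac (by simp)).smul_measure ENNReal.ofReal_ne_top]
    simp [integral_smul_measure, hπ]
  have h := (hasSubgaussianMGF_of_mem_Icc (μ := μ) (X := v) (a := 0) (b := 1)
    measurable_from_top.aemeasurable (ae_of_all _ hv)).mgf_le s
  simp only [mgf, hint] at h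
  refine h.trans_eq ?_
  congr 1
  norm_num
  ring

/-- The exponential moment of `t` independent samples, recentred at a value `c` at least `δ` above
the mean. -/
theorem sum_prod_mul_exp_sum_le {R : Type*} [Fintype R]
    (π : R → ℝ) (hπ : ∀ r, 0 ≤ π r) (hπ1 : ∑ r, π r = 1)
    (v : R → ℝ) (hv : ∀ r, v r ∈ Set.Icc 0 1) {c δ : ℝ} (hδ : 0 ≤ δ)
    (hc : ∑ r, π r * v r + δ ≤ c) (t : ℕ) :
    ∑ f : Fin t → R, (∏ i, π (f i)) * Real.exp (4 * δ * ∑ i, (v (f i) - c)) ≤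
      Real.exp (-2 * δ ^ 2 * t) := by
  have key : ∑ r, π r * Real.exp (4 * δ * (v r - c)) ≤ Real.exp (-2 * δ ^ 2) := by
    set m := ∑ r, π r * v r
    calc ∑ r, π r * Real.exp (4 * δ * (v r - c))
        ≤ ∑ r, π r * Real.exp (4 * δ * (v r - m)) * Real.exp (-(4 * δ ^ 2)) := by
          refine Finset.sum_le_sum fun r _ ↦ ?_
          rw [mul_assoc (π r), ← Real.exp_add]
          refine mul_le_mul_of_nonneg_left (Real.exp_le_exp.2 ?_) (hπ r)
          nlinarith
      _ ≤ Real.exp ((4 * δ) ^ 2 / 8) * Real.exp (-(4 * δ ^ 2)) := by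
          rw [← Finset.sum_mul]
          gcongr
          exact sum_mul_exp_le_of_mem_Icc_zero_one π hπ hπ1 v hv _
      _ = Real.exp (-2 * δ ^ 2) := by
          rw [← Real.exp_add]
          ring_nf
  calc _ = (∑ r, π r * Real.exp (4 * δ * (v r - c))) ^ t := by
        simp only [Fintype.sum_pow, Finset.mul_sum, Real.exp_sum, Finset.prod_mul_distrib]
    _ ≤ Real.exp (-2 * δ ^ 2) ^ t :=
        pow_le_pow_left₀ (Finset.sum_nonneg fun r _ ↦ mul_nonneg (hπ r) (Real.exp_pos _).le) key t
    _ = _ := by rw [← Real.exp_nat_mul, mul_comm]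

/-- Probabilistic-method core of Newman's theorem for relations: if for every
input pair `(x, y)` the average of `V x y r` over `r ~ π` is at most `ε`, then
for any `t` with `2·|X|·|Y|·exp(−2δ²t) < 1` there are fixed samples
`r₁, …, r_t` whose empirical average is at most `ε + δ` uniformly in `(x, y)`. -/
theorem newman_sampling
    {X Y R : Type*} [Fintype X] [Fintype Y] [Fintype R] [Nonempty R]
    (π : R → ℝ) (hπ : ∀ r, 0 ≤ π r) (hπ1 : ∑ r, π r = 1)
    (V : X → Y → R → ℝ) (hV0 : ∀ x y r, 0 ≤ V x y r) (hV1 : ∀ x y r, V x y r ≤ 1)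
    (ε δ : ℝ) (hε : 0 < ε) (hδ : 0 < δ)
    (havg : ∀ x y, ∑ r, π r * V x y r ≤ ε)
    (t : ℕ) (ht : 0 < t)
    (htbig : 2 * (Fintype.card X : ℝ) * (Fintype.card Y : ℝ) *
        Real.exp (-2 * δ ^ 2 * t) < 1) :
    ∃ f : Fin t → R, ∀ x y, (1 / (t : ℝ)) * ∑ i, V x y (f i) ≤ ε + δ := by
  let F (f : Fin t → R) (x : X) (y : Y) : ℝ :=
    Real.exp (4 * δ * ∑ i, (V x y (f i) - (ε + δ)))
  have hbound : ∑ f : Fin t → R, (∏ i, π (f i)) * ∑ x, ∑ y, F f x y ≤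
      Fintype.card X * Fintype.card Y * Real.exp (-2 * δ ^ 2 * t) := by
    calc _ = ∑ x, ∑ y, ∑ f : Fin t → R, (∏ i, π (f i)) * F f x y := by
          simp only [Finset.mul_sum]
          rw [Finset.sum_comm]
          exact Finset.sum_congr rfl fun x _ ↦ Finset.sum_comm
      _ ≤ ∑ _x : X, ∑ _y : Y, Real.exp (-2 * δ ^ 2 * t) :=
          Finset.sum_le_sum fun x _ ↦ Finset.sum_le_sum fun y _ ↦
            sum_prod_mul_exp_sum_le π hπ hπ1 (V x y) (fun r ↦ ⟨hV0 x y r, hV1 x y r⟩) hδ.le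
              (by linarith [havg x y]) t
      _ = _ := by simp [mul_assoc]
  have hlt : Fintype.card X * Fintype.card Y * Real.exp (-2 * δ ^ 2 * t) < 1 := by
    have : 0 ≤ Fintype.card X * Fintype.card Y * Real.exp (-2 * δ ^ 2 * t) := by positivity
    linarith
  have hweight : ∑ f : Fin t → R, ∏ i, π (f i) = 1 := by
    rw [← Fintype.sum_pow, hπ1, one_pow]
  obtain ⟨f, hf⟩ : ∃ f : Fin t → R, ∑ x, ∑ y, F f x y < 1 := by
    by_contra! h
    have : ∑ f : Fin t → R, ∏ i, π (f i) ≤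
        ∑ f : Fin t → R, (∏ i, π (f i)) * ∑ x, ∑ y, F f x y :=
      Finset.sum_le_sum fun f _ ↦
        le_mul_of_one_le_right (Finset.prod_nonneg fun i _ ↦ hπ (f i)) (h f)
    linarith
  refine ⟨f, fun x y ↦ ?_⟩
  have hF (x : X) (y : Y) : 0 ≤ F f x y := (Real.exp_pos _).le
  have hxy : F f x y < 1 :=
    ((Finset.single_le_sum (fun y _ ↦ hF x y) (Finset.mem_univ y)).trans
      (Finset.single_le_sum (f := fun x ↦ ∑ y, F f x y)
        (fun x _ ↦ Finset.sum_nonneg fun y _ ↦ hF x y) (Finset.mem_univ x))).trans_lt hf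
  have hneg : ∑ i, (V x y (f i) - (ε + δ)) < 0 :=
    neg_of_mul_neg_right (Real.exp_lt_one_iff.1 hxy) (by positivity)
  simp only [Finset.sum_sub_distrib, Finset.sum_const, Finset.card_univ, Fintype.card_fin,
    nsmul_eq_mul] at hneg
  rw [one_div, inv_mul_le_iff₀ (by positivity)]
  linarith
end

section
/- There exist universal constants c > 0 and c' > 0 such that the following holds. For every two-player non-local game G = (X, Y, A, B, P, V) whose classical value equals 1 − ε for some 0 < ε ≤ 1/2, and for every positive integer n, the classical value of the n-fold parallel repetition G^{⊗n} is at most (1 − ε^c)^{c'·n/s}, where s = log₂(|A|·|B|) + 1. -/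
open Finset

lemma exists_sum_stochastic_le {X A : Type*} [Fintype X] [Fintype A] (h q : X → A → ℝ)
    (hq : ∀ x a, 0 ≤ q x a) (hq1 : ∀ x, ∑ a, q x a = 1) :
    ∃ a : X → A, ∑ x, ∑ a, q x a * h x a ≤ ∑ x, h x (a x) := by
  have key : ∀ x, ∃ a, ∑ a', q x a' * h x a' ≤ h x a := by
    intro x
    have hne : (univ : Finset A).Nonempty := by
      by_contra hc
      have := hq1 x
      rw [not_nonempty_iff_eq_empty.1 hc] at this
      simp at this
    obtain ⟨a, -, ha⟩ := exists_max_image univ (h x) hne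
    refine ⟨a, ?_⟩
    calc ∑ a', q x a' * h x a' ≤ ∑ a', q x a' * h x a :=
          sum_le_sum fun a' _ => mul_le_mul_of_nonneg_left (ha a' (mem_univ _)) (hq x a')
      _ = h x a := by rw [← sum_mul, hq1, one_mul]
  choose a ha using key
  exact ⟨a, sum_le_sum fun x _ => ha x⟩

/-- Mixed product strategies do no better than deterministic ones. -/
lemma mixed_strategy_le {X Y A B : Type*} [Fintype X] [Fintype Y] [Fintype A] [Fintype B]
    (Z : X → Y → A → B → ℝ) (M : ℝ)
    (hM : ∀ (a : X → A) (b : Y → B), ∑ x, ∑ y, Z x y (a x) (b y) ≤ M)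
    (q : X → A → ℝ) (hq : ∀ x a, 0 ≤ q x a) (hq1 : ∀ x, ∑ a, q x a = 1)
    (r : Y → B → ℝ) (hr : ∀ y b, 0 ≤ r y b) (hr1 : ∀ y, ∑ b, r y b = 1) :
    ∑ x, ∑ y, ∑ a, ∑ b, q x a * r y b * Z x y a b ≤ M := by
  obtain ⟨a, ha⟩ := exists_sum_stochastic_le (fun x a => ∑ y, ∑ b, r y b * Z x y a b) q hq hq1
  obtain ⟨b, hb⟩ := exists_sum_stochastic_le (fun y b => ∑ x, Z x y (a x) b) r hr hr1
  calc ∑ x, ∑ y, ∑ a, ∑ b, q x a * r y b * Z x y a b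
      = ∑ x, ∑ a, q x a * ∑ y, ∑ b, r y b * Z x y a b := by
        refine sum_congr rfl fun x _ => ?_
        rw [sum_comm]
        simp only [mul_sum, mul_assoc]
    _ ≤ ∑ x, ∑ y, ∑ b, r y b * Z x y (a x) b := ha
    _ = ∑ y, ∑ b, r y b * ∑ x, Z x y (a x) b := by
        rw [sum_comm]
        refine sum_congr rfl fun y _ => ?_
        rw [sum_comm]
        simp only [mul_sum]
    _ ≤ ∑ y, ∑ x, Z x y (a x) (b y) := hb
    _ = ∑ x, ∑ y, Z x y (a x) (b y) := sum_comm
    _ ≤ M := hM a b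

open Classical in
/-- Correlated sampling: the players repeatedly draw a shared `ω` with weight `w ω` until one of
them accepts it.  The bound is on the payoff collected when both accept at the same time. -/
lemma correlated_sampling {X Y A B Ω : Type*} [Fintype X] [Fintype Y] [Fintype A] [Fintype B]
    [Fintype Ω] [Nonempty A] [Nonempty B]
    (T : X → Y → A → B → ℝ) (hT : ∀ x y a b, 0 ≤ T x y a b) (M : ℝ) (hM0 : 0 ≤ M)
    (hM : ∀ (a : X → A) (b : Y → B), ∑ x, ∑ y, T x y (a x) (b y) ≤ M)
    (w : Ω → ℝ) (hw : ∀ ω, 0 ≤ w ω) (SA : X → Ω → Prop) (SB : Y → Ω → Prop)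
    (q : Ω → X → A → ℝ) (hq : ∀ ω x a, 0 ≤ q ω x a) (hq1 : ∀ ω x, ∑ a, q ω x a = 1)
    (r : Ω → Y → B → ℝ) (hr : ∀ ω y b, 0 ≤ r ω y b) (hr1 : ∀ ω y, ∑ b, r ω y b = 1) :
    ∑ x, ∑ y, (∑ ω, if SA x ω ∧ SB y ω then
        w ω * ∑ a, ∑ b, q ω x a * r ω y b * T x y a b else 0) /
        (∑ ω, if SA x ω ∨ SB y ω then w ω else 0) ≤ M := by
  set U : X → Y → ℝ := fun x y => ∑ ω, if SA x ω ∨ SB y ω then w ω else 0 with hU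
  set D : X → Y → ℝ := fun x y => ∑ ω, if SA x ω ∨ SB y ω then 0 else w ω with hD
  set L : ℝ := ∑ ω, w ω with hL
  have hU0 : ∀ x y, 0 ≤ U x y := fun x y => sum_nonneg fun ω _ => by split_ifs <;> simp [hw]
  have hD0 : ∀ x y, 0 ≤ D x y := fun x y => sum_nonneg fun ω _ => by split_ifs <;> simp [hw]
  have hUD : ∀ x y, L = U x y + D x y := by
    intro x y
    simp only [hL, hU, hD, ← sum_add_distrib]
    exact sum_congr rfl fun ω _ => by split_ifs <;> simp
  have hL0 : 0 ≤ L := sum_nonneg fun ω _ => hw ω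
  rcases hL0.eq_or_lt with h0 | hLpos
  · have hw0 : ∀ ω, w ω = 0 := by
      intro ω
      exact (sum_eq_zero_iff_of_nonneg (fun ω _ => hw ω)).1 h0.symm ω (mem_univ _)
    simpa [hw0] using hM0
  set Z : X → Y → A → B → ℝ := fun x y a b => T x y a b / U x y with hZ
  have hZ0 : ∀ x y a b, 0 ≤ Z x y a b := fun x y a b => div_nonneg (hT _ _ _ _) (hU0 _ _)
  have hZU : ∀ x y a b, Z x y a b * U x y ≤ T x y a b := by
    intro x y a b
    rcases eq_or_ne (U x y) 0 with h | h
    · simp [h, hT]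
    · simp [hZ, h]
  obtain ⟨⟨as, bs⟩, -, hmax⟩ := exists_max_image (univ : Finset ((X → A) × (Y → B)))
    (fun s => ∑ x, ∑ y, Z x y (s.1 x) (s.2 y) * D x y) univ_nonempty
  set E := ∑ x, ∑ y, Z x y (as x) (bs y) * D x y with hE
  have hdet : ∀ (a : X → A) (b : Y → B), ∑ x, ∑ y, Z x y (a x) (b y) * L ≤ M + E := by
    intro a b
    have h1 := hmax (a, b) (mem_univ _)
    have h2 : ∑ x, ∑ y, Z x y (a x) (b y) * U x y ≤ M :=
      (sum_le_sum fun x _ => sum_le_sum fun y _ => hZU _ _ _ _).trans (hM a b)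
    have h3 : ∑ x, ∑ y, Z x y (a x) (b y) * L
        = ∑ x, ∑ y, Z x y (a x) (b y) * U x y + ∑ x, ∑ y, Z x y (a x) (b y) * D x y := by
      simp only [← sum_add_distrib, ← mul_add]
      exact sum_congr rfl fun x _ => sum_congr rfl fun y _ => by rw [← hUD]
    linarith
  set q' : Ω → X → A → ℝ := fun ω x a => if SA x ω then q ω x a else if a = as x then 1 else 0
    with hq'
  set r' : Ω → Y → B → ℝ := fun ω y b => if SB y ω then r ω y b else if b = bs y then 1 else 0
    with hr'
  have hq'0 : ∀ ω x a, 0 ≤ q' ω x a := by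
    intro ω x a; simp only [hq']; split_ifs <;> simp [hq]
  have hr'0 : ∀ ω y b, 0 ≤ r' ω y b := by
    intro ω x a; simp only [hr']; split_ifs <;> simp [hr]
  have hmix : ∀ ω, (∑ x, ∑ y, ∑ a, ∑ b, q' ω x a * r' ω y b * Z x y a b) * L ≤ M + E := by
    intro ω
    have := mixed_strategy_le (fun x y a b => Z x y a b * L) (M + E) hdet (q' ω) (hq'0 ω)
      (by intro x; simp only [hq']; split_ifs <;> simp [hq1])
      (r' ω) (hr'0 ω) (by intro x; simp only [hr']; split_ifs <;> simp [hr1])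
    simpa only [sum_mul, ← mul_assoc] using this
  have hlow : ∀ x y, (∑ ω, if SA x ω ∧ SB y ω then
        w ω * ∑ a, ∑ b, q ω x a * r ω y b * T x y a b else 0) / U x y
        + Z x y (as x) (bs y) * D x y
        ≤ ∑ ω, w ω * ∑ a, ∑ b, q' ω x a * r' ω y b * Z x y a b := by
    intro x y
    simp only [hD, mul_sum (s := univ (α := Ω)), sum_div, ← sum_add_distrib]
    refine sum_le_sum fun ω _ => ?_
    have hpos : 0 ≤ w ω * ∑ a, ∑ b, q' ω x a * r' ω y b * Z x y a b :=
      mul_nonneg (hw ω) (sum_nonneg fun a _ => sum_nonneg fun b _ =>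
        mul_nonneg (mul_nonneg (hq'0 _ _ _) (hr'0 _ _ _)) (hZ0 _ _ _ _))
    by_cases h1 : SA x ω <;> by_cases h2 : SB y ω
    · simp only [h1, h2, hq', hr', hZ]
      simp only [and_self, or_self, if_true, mul_zero, add_zero, mul_div_assoc, sum_div, le_refl]
    · simpa [h1, h2] using hpos
    · simpa [h1, h2] using hpos
    · simp [h1, h2, hq', hr', mul_comm]
  have hsum : (∑ x, ∑ y, (∑ ω, if SA x ω ∧ SB y ω then
        w ω * ∑ a, ∑ b, q ω x a * r ω y b * T x y a b else 0) / U x y) + E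
      ≤ ∑ ω, w ω * ∑ x, ∑ y, ∑ a, ∑ b, q' ω x a * r' ω y b * Z x y a b := by
    calc _ ≤ ∑ x, ∑ y, ∑ ω, w ω * ∑ a, ∑ b, q' ω x a * r' ω y b * Z x y a b := by
          rw [hE]
          simp only [← sum_add_distrib]
          exact sum_le_sum fun x _ => sum_le_sum fun y _ => hlow x y
      _ = _ := by
          have hswap : ∀ g : Ω → X → Y → ℝ,
              ∑ x, ∑ y, ∑ ω, w ω * g ω x y = ∑ ω, w ω * ∑ x, ∑ y, g ω x y := by
            intro g
            simp_rw [mul_sum]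
            rw [sum_comm (s := univ (α := Ω))]
            exact sum_congr rfl fun x _ => sum_comm
          exact hswap _
  have hfin : (∑ ω, w ω * ∑ x, ∑ y, ∑ a, ∑ b, q' ω x a * r' ω y b * Z x y a b) ≤ M + E := by
    rw [← mul_le_mul_iff_left₀ hLpos, sum_mul]
    calc _ ≤ ∑ ω, w ω * (M + E) := sum_le_sum fun ω _ => by
            rw [mul_assoc]; exact mul_le_mul_of_nonneg_left (hmix ω) (hw ω)
      _ = _ := by rw [← sum_mul, mul_comm]
  linarith

/-- A finite layer-cake decomposition. -/
lemma exists_layer_weights (s : Finset ℝ) (hs : ∀ t ∈ s, 0 ≤ t) :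
    ∃ w : ℝ → ℝ, (∀ v, 0 ≤ w v) ∧ ∀ t ∈ s, ∑ v ∈ s, (if v ≤ t then w v else 0) = t := by
  induction s using Finset.induction_on_max with
  | empty => exact ⟨0, by simp⟩
  | insert m s hlt ih =>
    obtain ⟨w, hw, hw'⟩ := ih fun t ht => hs t (mem_insert_of_mem ht)
    have hle : ∑ v ∈ s, w v ≤ m := by
      rcases s.eq_empty_or_nonempty with rfl | hne
      · simpa using hs m (by simp)
      · have h1 := hw' _ (s.max'_mem hne)
        rw [sum_congr rfl fun v hv => if_pos (s.le_max' v hv)] at h1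
        rw [h1]
        exact (hlt _ (s.max'_mem hne)).le
    have hm : m ∉ s := fun h => lt_irrefl _ (hlt m h)
    set w' := Function.update w m (m - ∑ v ∈ s, w v) with hw'def
    have hwm : w' m = m - ∑ v ∈ s, w v := Function.update_self _ _ _
    have hupd : ∀ v ∈ s, w' v = w v := fun v hv =>
      Function.update_of_ne (ne_of_mem_of_not_mem hv hm) _ _
    have hsum : ∀ t, ∑ v ∈ s, (if v ≤ t then w' v else 0)
        = ∑ v ∈ s, (if v ≤ t then w v else 0) := fun t =>
      sum_congr rfl fun v hv => by rw [hupd v hv]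
    refine ⟨w', ?_, ?_⟩
    · intro v
      rcases eq_or_ne v m with rfl | h
      · rw [hwm]; linarith
      · simpa [hw'def, Function.update_of_ne h] using hw v
    · intro t ht
      rw [sum_insert hm, hsum, hwm]
      rcases mem_insert.1 ht with rfl | ht
      · rw [sum_congr rfl fun v hv => if_pos (hlt v hv).le, if_pos le_rfl]
        ring
      · rw [hw' t ht, if_neg (not_le.2 (hlt t ht)), zero_add]

lemma correlated_sampling_min_max {X Y A B R : Type*} [Fintype X] [Fintype Y] [Fintype A]
    [Fintype B] [Fintype R] [Nonempty A] [Nonempty B]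
    (T : X → Y → A → B → ℝ) (hT : ∀ x y a b, 0 ≤ T x y a b) (M : ℝ) (hM0 : 0 ≤ M)
    (hM : ∀ (a : X → A) (b : Y → B), ∑ x, ∑ y, T x y (a x) (b y) ≤ M)
    (α : X → R → ℝ) (hα : ∀ x r, 0 ≤ α x r) (β : Y → R → ℝ) (hβ : ∀ y r, 0 ≤ β y r)
    (q : R → X → A → ℝ) (hq : ∀ ω x a, 0 ≤ q ω x a) (hq1 : ∀ ω x, ∑ a, q ω x a = 1)
    (q' : R → Y → B → ℝ) (hq' : ∀ ω y b, 0 ≤ q' ω y b) (hq'1 : ∀ ω y, ∑ b, q' ω y b = 1) :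
    ∑ x, ∑ y, (∑ r, min (α x r) (β y r) * ∑ a, ∑ b, q r x a * q' r y b * T x y a b) /
        (∑ r, max (α x r) (β y r)) ≤ M := by
  classical
  set s : Finset ℝ := (univ.image fun z : X × R => α z.1 z.2) ∪
    (univ.image fun z : Y × R => β z.1 z.2) with hs
  have hαs : ∀ x r, α x r ∈ s := fun x r =>
    mem_union_left _ (mem_image.2 ⟨(x, r), mem_univ _, rfl⟩)
  have hβs : ∀ y r, β y r ∈ s := fun x r =>
    mem_union_right _ (mem_image.2 ⟨(x, r), mem_univ _, rfl⟩)
  obtain ⟨w, hw, hws⟩ := exists_layer_weights s (by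
    intro t ht
    rcases mem_union.1 ht with h | h <;> obtain ⟨z, -, rfl⟩ := mem_image.1 h
    exacts [hα _ _, hβ _ _])
  have hmin : ∀ x y r, min (α x r) (β y r) ∈ s := fun x y r => by
    rcases min_choice (α x r) (β y r) with h | h <;> rw [h]
    exacts [hαs _ _, hβs _ _]
  have hmax : ∀ x y r, max (α x r) (β y r) ∈ s := fun x y r => by
    rcases max_choice (α x r) (β y r) with h | h <;> rw [h]
    exacts [hαs _ _, hβs _ _]
  have key := correlated_sampling (Ω := R × s) T hT M hM0 hM (fun ω => w ω.2) (fun ω => hw _)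
    (fun x ω => (ω.2 : ℝ) ≤ α x ω.1) (fun y ω => (ω.2 : ℝ) ≤ β y ω.1)
    (fun ω => q ω.1) (fun ω => hq _) (fun ω => hq1 _)
    (fun ω => q' ω.1) (fun ω => hq' _) (fun ω => hq'1 _)
  refine le_of_eq_of_le (sum_congr rfl fun x _ => sum_congr rfl fun y _ => ?_) key
  congr 1
  · rw [Fintype.sum_prod_type]
    refine sum_congr rfl fun r _ => ?_
    nth_rewrite 1 [← hws _ (hmin x y r)]
    rw [sum_mul, ← sum_coe_sort s]
    refine sum_congr rfl fun v _ => ?_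
    simp only [le_min_iff, ite_mul, zero_mul]
  · rw [Fintype.sum_prod_type]
    refine sum_congr rfl fun r _ => ?_
    nth_rewrite 1 [← hws _ (hmax x y r)]
    rw [← sum_coe_sort s]
    refine sum_congr rfl fun v _ => ?_
    simp only [le_max_iff]
/-- If `α` and `β` both approximate the tilted measure `μ`, correlated sampling from `α` and `β`
reproduces the payoff of `μ`. -/
lemma payoff_le_of_min_max {X Y R : Type*} [Fintype X] [Fintype Y] [Fintype R]
    (P : X → Y → ℝ) (hP : ∀ x y, 0 ≤ P x y) (μ c : X → Y → R → ℝ)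
    (hc0 : ∀ x y r, 0 ≤ c x y r) (hc1 : ∀ x y r, c x y r ≤ 1)
    (α : X → R → ℝ) (hα : ∀ x r, 0 ≤ α x r) (β : Y → R → ℝ) (hβ : ∀ y r, 0 ≤ β y r)
    (M p : ℝ) (hp : 0 ≤ p)
    (h : ∑ x, ∑ y, P x y * ((∑ r, min (α x r) (β y r) * c x y r) /
      (∑ r, max (α x r) (β y r))) ≤ M) :
    ∑ x, ∑ y, ∑ r, μ x y r * c x y r ≤ p * M
      + 2 * ∑ x, ∑ y, ∑ r, |μ x y r - P x y * α x r|
      + 2 * ∑ x, ∑ y, ∑ r, |μ x y r - P x y * β y r|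
      + ∑ x, ∑ y, |∑ r, μ x y r - p * P x y| := by
  have key : ∀ x y, ∑ r, μ x y r * c x y r ≤
      p * (P x y * ((∑ r, min (α x r) (β y r) * c x y r) / (∑ r, max (α x r) (β y r))))
      + 2 * ∑ r, |μ x y r - P x y * α x r| + 2 * ∑ r, |μ x y r - P x y * β y r|
      + |∑ r, μ x y r - p * P x y| := by
    intro x y
    set m := ∑ r, min (α x r) (β y r) * c x y r with hm
    set U := ∑ r, max (α x r) (β y r) with hU
    set a := ∑ r, |μ x y r - P x y * α x r| with ha
    set b := ∑ r, |μ x y r - P x y * β y r| with hb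
    have hm0 : 0 ≤ m := sum_nonneg fun r _ => mul_nonneg (le_min (hα _ _) (hβ _ _)) (hc0 _ _ _)
    have hmU : m ≤ U := sum_le_sum fun r _ => by
      calc min (α x r) (β y r) * c x y r ≤ min (α x r) (β y r) * 1 :=
            mul_le_mul_of_nonneg_left (hc1 _ _ _) (le_min (hα _ _) (hβ _ _))
        _ ≤ _ := by rw [mul_one]; exact min_le_max
    have h1 : ∑ r, μ x y r * c x y r ≤ P x y * m + a + b := by
      rw [hm, ha, hb, mul_sum, ← sum_add_distrib, ← sum_add_distrib]
      refine sum_le_sum fun r _ => ?_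
      have e : μ x y r - P x y * min (α x r) (β y r) ≤
          |μ x y r - P x y * α x r| + |μ x y r - P x y * β y r| := by
        rcases min_choice (α x r) (β y r) with h | h <;> rw [h]
        · exact (le_abs_self _).trans (le_add_of_nonneg_right (abs_nonneg _))
        · exact (le_abs_self _).trans (le_add_of_nonneg_left (abs_nonneg _))
      have e2 : (μ x y r - P x y * min (α x r) (β y r)) * c x y r ≤
          (|μ x y r - P x y * α x r| + |μ x y r - P x y * β y r|) * 1 :=
        (mul_le_mul_of_nonneg_right e (hc0 _ _ _)).trans
          (mul_le_mul_of_nonneg_left (hc1 _ _ _) (by positivity))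
      nlinarith
    have h2 : P x y * U - ∑ r, μ x y r ≤ a + b := by
      rw [hU, ha, hb, mul_sum, ← sum_add_distrib, ← sum_sub_distrib]
      refine sum_le_sum fun r _ => ?_
      rcases max_choice (α x r) (β y r) with h | h <;> rw [h]
      · rw [abs_sub_comm]
        exact (le_abs_self _).trans (le_add_of_nonneg_right (abs_nonneg _))
      · rw [abs_sub_comm (μ x y r) (P x y * β y r)]
        exact (le_abs_self _).trans (le_add_of_nonneg_left (abs_nonneg _))
    have h3 : m ≤ p * (m / U) + max (U - p) 0 := by
      rcases (hm0.trans hmU).eq_or_lt with h0 | hpos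
      · have : m = 0 := le_antisymm (h0 ▸ hmU) hm0
        simp [this]
      · have hr : m / U ≤ 1 := (div_le_one hpos).2 hmU
        have hr0 : 0 ≤ m / U := by positivity
        have he : m = U * (m / U) := by field_simp
        rcases le_total U p with hle | hle
        · nlinarith [le_max_right (U - p) 0]
        · nlinarith [le_max_left (U - p) 0]
    have h4 : P x y * max (U - p) 0 ≤ a + b + |∑ r, μ x y r - p * P x y| := by
      rcases max_choice (U - p) 0 with h | h <;> rw [h]
      · have := le_abs_self (∑ r, μ x y r - p * P x y)
        nlinarith
      · rw [mul_zero]; positivity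
    have h5 := mul_le_mul_of_nonneg_left h3 (hP x y)
    nlinarith
  calc ∑ x, ∑ y, ∑ r, μ x y r * c x y r ≤ ∑ x, ∑ y, _ :=
        sum_le_sum fun x _ => sum_le_sum fun y _ => key x y
    _ = p * ∑ x, ∑ y, P x y * ((∑ r, min (α x r) (β y r) * c x y r) /
          (∑ r, max (α x r) (β y r)))
        + 2 * ∑ x, ∑ y, ∑ r, |μ x y r - P x y * α x r|
        + 2 * ∑ x, ∑ y, ∑ r, |μ x y r - P x y * β y r|
        + ∑ x, ∑ y, |∑ r, μ x y r - p * P x y| := by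
        simp only [sum_add_distrib, ← mul_sum]
    _ ≤ _ := by gcongr

lemma sum_prod_one_add_martingale_ge {Y : Type*} [Fintype Y] :
    ∀ (m : ℕ) (p : Fin m → Y → ℝ) (t : Fin m → (Fin m → Y) → ℝ),
    (∀ i y y', (∀ j, i ≤ j → y j = y' j) → t i y = t i y') →
    (∀ i y, ∑ v, p i v * t i (Function.update y i v) = 0) →
    ∑ y : Fin m → Y, (∏ i, p i (y i)) * ∏ i, (1 + t i y) = ∏ i, ∑ v, p i v := by
  intro m
  induction m with
  | zero => intro p t _ _; simp
  | succ m ih =>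
    intro p t hdep hzero
    rw [← (Fin.consEquiv fun _ : Fin (m + 1) => Y).sum_comp, Fintype.sum_prod_type_right]
    rw [Fin.prod_univ_succ]
    rcases isEmpty_or_nonempty Y with hY | ⟨⟨y0⟩⟩
    · simp
    rw [← ih (fun i => p i.succ) (fun i y => t i.succ (Fin.cons y0 y))]
    · rw [mul_sum]
      refine sum_congr rfl fun y _ => ?_
      have h1 : ∀ v (i : Fin m), t i.succ (Fin.cons v y : Fin (m + 1) → Y)
          = t i.succ (Fin.cons y0 y : Fin (m + 1) → Y) := by
        intro v i
        refine hdep _ _ _ fun j hj => ?_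
        obtain ⟨k, rfl⟩ := Fin.exists_succ_eq.2 (Fin.pos_iff_ne_zero.1 (i.succ_pos.trans_le hj))
        simp
      have h2 := hzero 0 (Fin.cons y0 y)
      simp only [Fin.update_cons_zero] at h2
      calc _ = ∑ v, (p 0 v + p 0 v * t 0 (Fin.cons v y)) *
            ((∏ i : Fin m, p i.succ (y i)) *
              ∏ i : Fin m, (1 + t i.succ (Fin.cons y0 y : Fin (m + 1) → Y))) := by
            refine sum_congr rfl fun v _ => ?_
            simp only [Fin.consEquiv, Equiv.coe_fn_mk, Fin.prod_univ_succ, Fin.cons_zero,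
              Fin.cons_succ, h1 v]
            ring
        _ = _ := by
            rw [← sum_mul, sum_add_distrib, h2, add_zero]
    · intro i y y' hy
      refine hdep _ _ _ fun j hj => ?_
      obtain ⟨k, rfl⟩ := Fin.exists_succ_eq.2 (Fin.pos_iff_ne_zero.1 (i.succ_pos.trans_le hj))
      simpa using hy k (Fin.succ_le_succ_iff.1 hj)
    · intro i y
      simpa [Fin.cons_update] using hzero i.succ (Fin.cons y0 y)

lemma sum_prod_one_add_martingale_le {Y : Type*} [Fintype Y]
    (m : ℕ) (p : Fin m → Y → ℝ) (t : Fin m → (Fin m → Y) → ℝ)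
    (hdep : ∀ i y y', (∀ j, j ≤ i → y j = y' j) → t i y = t i y')
    (hzero : ∀ i y, ∑ v, p i v * t i (Function.update y i v) = 0) :
    ∑ y : Fin m → Y, (∏ i, p i (y i)) * ∏ i, (1 + t i y) = ∏ i, ∑ v, p i v := by
  have key := sum_prod_one_add_martingale_ge m (fun i => p i.rev)
    (fun i y => t i.rev (y ∘ Fin.rev)) ?_ ?_
  · rw [← Equiv.prod_comp Fin.revPerm fun i => ∑ v, p i v]
    refine Eq.trans ?_ key
    rw [← (Equiv.arrowCongr Fin.revPerm (Equiv.refl Y)).sum_comp]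
    refine sum_congr rfl fun y _ => ?_
    congr 1
    · rw [← Equiv.prod_comp Fin.revPerm]
      simp
    · rw [← Equiv.prod_comp Fin.revPerm]
      rfl
  · intro i y y' h
    exact hdep _ _ _ fun j hj => h _ (Fin.le_rev_iff.1 hj)
  · intro i y
    have := hzero i.rev (y ∘ Fin.rev)
    rw [← this]
    refine sum_congr rfl fun v _ => ?_
    congr 2
    ext j
    simp [Function.update_apply, Fin.rev_eq_iff]

/-- An event of probability at least `exp (-δ m)` cannot bias the bounded increments `t i` much
when the product of the `1 + l * t i` has mean one. -/
lemma sum_tilted_le {Ω : Type*} [Fintype Ω] {m : ℕ} (π h : Ω → ℝ) (hπ : ∀ ω, 0 ≤ π ω)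
    (hh0 : ∀ ω, 0 ≤ h ω) (hh1 : ∀ ω, h ω ≤ 1) (t : Fin m → Ω → ℝ) (ht : ∀ i ω, |t i ω| ≤ 2)
    (l : ℝ) (hl0 : 0 < l) (hl : l ≤ 1 / 4)
    (hmean : ∑ ω, π ω * ∏ i, (1 + l * t i ω) ≤ 1) (δ : ℝ)
    (hp : Real.exp (-(δ * m)) ≤ ∑ ω, π ω * h ω) :
    ∑ i, ∑ ω, π ω * h ω * t i ω ≤ (∑ ω, π ω * h ω) * (m * (δ / l + 8 * l)) := by
  set Z : Ω → ℝ := fun ω => ∑ i, (l * t i ω - 8 * l ^ 2) with hZ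
  have hbd : ∀ i ω, -(1/2) ≤ l * t i ω ∧ l * t i ω ≤ 1/2 := by
    intro i ω
    have := abs_le.1 (ht i ω)
    constructor <;> nlinarith
  have hfac : ∀ i ω, Real.exp (l * t i ω - 8 * l ^ 2) ≤ 1 + l * t i ω := by
    intro i ω
    have h1 := hbd i ω
    have hpos : 0 < 1 + l * t i ω := by linarith
    rw [← Real.le_log_iff_exp_le hpos]
    refine le_trans ?_ (Real.one_sub_inv_le_log_of_pos hpos)
    have h2 : (1 + l * t i ω) * (1 + l * t i ω)⁻¹ = 1 := mul_inv_cancel₀ hpos.ne'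
    have h3 : (l * t i ω) ^ 2 ≤ 4 * l ^ 2 := by
      have := abs_le.1 (ht i ω)
      have : t i ω ^ 2 ≤ 4 := by nlinarith
      nlinarith [sq_nonneg l]
    have h4 : (1 + l * t i ω)⁻¹ ≤ 1 - l * t i ω + 2 * (l * t i ω) ^ 2 := by
      rw [inv_le_iff_one_le_mul₀ hpos]
      nlinarith [mul_nonneg (sq_nonneg (l * t i ω)) (by linarith : 0 ≤ 1 + 2 * (l * t i ω))]
    linarith
  have hexp : ∀ ω, Real.exp (Z ω) ≤ ∏ i, (1 + l * t i ω) := by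
    intro ω
    rw [hZ, Real.exp_sum]
    exact prod_le_prod (fun i _ => (Real.exp_pos _).le) fun i _ => hfac i ω
  have h1 : ∑ ω, π ω * h ω * Real.exp (Z ω - δ * m) ≤ ∑ ω, π ω * h ω := by
    refine le_trans ?_ hp
    calc ∑ ω, π ω * h ω * Real.exp (Z ω - δ * m)
        ≤ ∑ ω, Real.exp (-(δ * m)) * (π ω * ∏ i, (1 + l * t i ω)) := by
          refine sum_le_sum fun ω _ => ?_
          rw [sub_eq_add_neg, Real.exp_add]
          have : h ω * Real.exp (Z ω) ≤ 1 * ∏ i, (1 + l * t i ω) :=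
            mul_le_mul (hh1 ω) (hexp ω) (Real.exp_pos _).le zero_le_one
          calc π ω * h ω * (Real.exp (Z ω) * Real.exp (-(δ * m)))
              = Real.exp (-(δ * m)) * (π ω * (h ω * Real.exp (Z ω))) := by ring
            _ ≤ Real.exp (-(δ * m)) * (π ω * (1 * ∏ i, (1 + l * t i ω))) := by
                gcongr; exact hπ ω
            _ = _ := by rw [one_mul]
      _ ≤ Real.exp (-(δ * m)) := by
          rw [← mul_sum]
          exact mul_le_of_le_one_right (Real.exp_pos _).le hmean
  have h2 : ∑ ω, π ω * h ω * (Z ω - δ * m + 1) ≤ ∑ ω, π ω * h ω :=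
    le_trans (sum_le_sum fun ω _ => mul_le_mul_of_nonneg_left (Real.add_one_le_exp _)
      (mul_nonneg (hπ ω) (hh0 ω))) h1
  have h3 : ∑ ω, π ω * h ω * (Z ω - δ * m + 1)
      = l * (∑ i, ∑ ω, π ω * h ω * t i ω) - (∑ ω, π ω * h ω) * (m * (8 * l ^ 2) + δ * m)
        + ∑ ω, π ω * h ω := by
    rw [sum_comm (s := univ (α := Fin m)), mul_sum, sum_mul, ← sum_sub_distrib, ← sum_add_distrib]
    refine sum_congr rfl fun ω _ => ?_
    simp only [hZ, sum_sub_distrib, ← mul_sum]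
    simp
    ring
  have h4 : l * (∑ i, ∑ ω, π ω * h ω * t i ω) ≤
      l * ((∑ ω, π ω * h ω) * (m * (δ / l + 8 * l))) := by
    have : l * ((∑ ω, π ω * h ω) * (m * (δ / l + 8 * l)))
        = (∑ ω, π ω * h ω) * (m * (8 * l ^ 2) + δ * m) := by
      field_simp
      ring
    linarith
  exact le_of_mul_le_mul_left h4 hl0

/-- `ℓ¹`-duality for the distance between `μ` and its resampling along `Q`. -/
lemma exists_sign_sum_abs {X Y R : Type*} [Fintype X] [Fintype Y] [Fintype R]
    (μ : X → Y → R → ℝ) (Q : X → Y → ℝ) :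
    ∃ σ : X → Y → R → ℝ, (∀ x y r, |σ x y r| ≤ 1) ∧
      ∑ x, ∑ y, ∑ r, |μ x y r - Q x y * ∑ y', μ x y' r|
        = ∑ x, ∑ y, ∑ r, μ x y r * (σ x y r - ∑ y', Q x y' * σ x y' r) := by
  classical
  refine ⟨fun x y r => if 0 ≤ μ x y r - Q x y * ∑ y', μ x y' r then 1 else -1, ?_, ?_⟩
  · intro x y r
    simp only
    split_ifs <;> simp
  · refine sum_congr rfl fun x _ => ?_
    rw [sum_comm, sum_comm (s := univ (α := Y))]
    refine sum_congr rfl fun r _ => ?_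
    set σ : Y → ℝ := fun y => if 0 ≤ μ x y r - Q x y * ∑ y', μ x y' r then 1 else -1 with hσ
    have h1 : ∀ y, |μ x y r - Q x y * ∑ y', μ x y' r|
        = μ x y r * σ y - (Q x y * σ y) * ∑ y', μ x y' r := by
      intro y
      simp only [hσ]
      split_ifs with h
      · rw [abs_of_nonneg h]; ring
      · rw [abs_of_neg (not_le.1 h)]; ring
    simp only [h1, mul_sub, sum_sub_distrib, ← sum_mul]
    rw [mul_comm (∑ y', Q x y' * σ y')]

lemma exists_sign_sum_abs_marginal {X Y R : Type*} [Fintype X] [Fintype Y] [Fintype R]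
    (μ : X → Y → R → ℝ) (P : X → Y → ℝ) :
    ∃ σ : X → Y → ℝ, (∀ x y, |σ x y| ≤ 1) ∧
      ∑ x, ∑ y, |∑ r, μ x y r - (∑ x, ∑ y, ∑ r, μ x y r) * P x y|
        = ∑ x, ∑ y, ∑ r, μ x y r * (σ x y - ∑ x', ∑ y', P x' y' * σ x' y') := by
  classical
  set p := ∑ x, ∑ y, ∑ r, μ x y r with hp
  set σ : X → Y → ℝ := fun x y => if 0 ≤ ∑ r, μ x y r - p * P x y then 1 else -1 with hσ
  refine ⟨σ, ?_, ?_⟩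
  · intro x y
    simp only [hσ]
    split_ifs <;> simp
  · have h1 : ∀ x y, |∑ r, μ x y r - p * P x y|
        = (∑ r, μ x y r) * σ x y - p * (P x y * σ x y) := by
      intro x y
      simp only [hσ]
      split_ifs with h
      · rw [abs_of_nonneg h]; ring
      · rw [abs_of_neg (not_le.1 h)]; ring
    simp only [h1, mul_sub, sum_sub_distrib, ← sum_mul, ← mul_sum]
    rw [← hp]

/-- The dependency-breaking variable for coordinate `i`: it reveals `x j` for `j < i` and `y j` for
`j > i`. -/
def revealed {X Y : Type*} {m : ℕ} (i : Fin (m + 1)) (x : Fin (m + 1) → X)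
    (y : Fin (m + 1) → Y) (j : Fin m) : X ⊕ Y :=
  if i.succAbove j < i then Sum.inl (x (i.succAbove j)) else Sum.inr (y (i.succAbove j))

lemma revealed_congr_right {X Y : Type*} {m : ℕ} (i : Fin (m + 1)) (x : Fin (m + 1) → X)
    (y y' : Fin (m + 1) → Y) (h : ∀ j, i < j → y j = y' j) :
    revealed i x y = revealed i x y' := by
  ext1 j
  unfold revealed
  split_ifs with hj
  · rfl
  · rw [h _ (lt_of_le_of_ne (not_lt.1 hj) (Fin.succAbove_ne i j).symm)]

lemma revealed_congr_left {X Y : Type*} {m : ℕ} (i : Fin (m + 1)) (x x' : Fin (m + 1) → X)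
    (y : Fin (m + 1) → Y) (h : ∀ j, j < i → x j = x' j) :
    revealed i x y = revealed i x' y := by
  ext1 j
  unfold revealed
  split_ifs with hj
  · rw [h _ hj]
  · rfl

/-- Given the revealed variable, the unrevealed parts of the two question tuples are
independent. -/
lemma exists_revealed_factorization {X Y : Type*} (P : X → Y → ℝ)
    (hP : ∀ x y, 0 ≤ P x y) {m : ℕ} (i : Fin (m + 1)) :
    ∃ (u : (Fin m → X ⊕ Y) → (Fin m → X) → ℝ) (v : (Fin m → X ⊕ Y) → (Fin m → Y) → ℝ),
      (∀ c x, 0 ≤ u c x) ∧ (∀ c y, 0 ≤ v c y) ∧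
      ∀ c x y, (c = (fun j => if i.succAbove j < i then Sum.inl (x j) else Sum.inr (y j)) →
          u c x * v c y = ∏ j, P (x j) (y j)) ∧
        (c ≠ (fun j => if i.succAbove j < i then Sum.inl (x j) else Sum.inr (y j)) →
          u c x * v c y = 0) := by
  classical
  have single : ∀ d : Prop, ∃ (u : X ⊕ Y → X → ℝ) (v : X ⊕ Y → Y → ℝ),
      (∀ c x, 0 ≤ u c x) ∧ (∀ c y, 0 ≤ v c y) ∧
      ∀ c x y, u c x * v c y = if c = (if d then Sum.inl x else Sum.inr y) then P x y else 0 := by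
    intro d
    by_cases hd : d
    · refine ⟨fun c x => if c = Sum.inl x then 1 else 0, fun c y => Sum.elim (P · y) 0 c,
        ?_, ?_, ?_⟩
      · intro c x; simp only; split_ifs <;> simp
      · rintro (c | c) y <;> simp [hP]
      · intro c x y
        simp only [hd, if_true]
        split_ifs with h
        · simp [h]
        · simp
    · refine ⟨fun c x => Sum.elim 0 (P x ·) c, fun c y => if c = Sum.inr y then 1 else 0,
        ?_, ?_, ?_⟩
      · rintro (c | c) y <;> simp [hP]
      · intro c x; simp only; split_ifs <;> simp
      · intro c x y
        simp only [hd, if_false]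
        split_ifs with h
        · simp [h]
        · simp
  choose u v hu hv huv using single
  refine ⟨fun c x => ∏ j, u (i.succAbove j < i) (c j) (x j),
    fun c y => ∏ j, v (i.succAbove j < i) (c j) (y j),
    fun c x => prod_nonneg fun j _ => hu _ _ _, fun c x => prod_nonneg fun j _ => hv _ _ _, ?_⟩
  intro c x y
  simp only [← prod_mul_distrib, huv]
  constructor
  · rintro rfl
    refine prod_congr rfl fun j _ => ?_
    split_ifs <;> simp_all
  · intro h
    obtain ⟨j, hj⟩ := Function.ne_iff.1 h
    refine prod_eq_zero (mem_univ j) ?_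
    rw [if_neg]
    intro h'
    apply hj
    rw [h']
    split_ifs <;> rfl

lemma sum_revealed {X Y : Type*} [Fintype X] [Fintype Y] (P : X → Y → ℝ) {m : ℕ}
    (i : Fin (m + 1))
    (u : (Fin m → X ⊕ Y) → (Fin m → X) → ℝ) (v : (Fin m → X ⊕ Y) → (Fin m → Y) → ℝ)
    (huv : ∀ c x y,
      (c = (fun j => if i.succAbove j < i then Sum.inl (x j) else Sum.inr (y j)) →
          u c x * v c y = ∏ j, P (x j) (y j)) ∧
        (c ≠ (fun j => if i.succAbove j < i then Sum.inl (x j) else Sum.inr (y j)) →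
          u c x * v c y = 0))
    (f : (Fin (m + 1) → X) → ℝ) (g : (Fin (m + 1) → Y) → ℝ)
    (φ : X → Y → (Fin m → X ⊕ Y) → ℝ) :
    ∑ x, ∑ y, ∑ c, P x y * (∑ x' : Fin m → X, u c x' * f (i.insertNth x x')) *
        (∑ y' : Fin m → Y, v c y' * g (i.insertNth y y')) * φ x y c
      = ∑ x : Fin (m + 1) → X, ∑ y : Fin (m + 1) → Y,
          (∏ j, P (x j) (y j)) * (f x * g y) * φ (x i) (y i) (revealed i x y) := by
  classical
  rw [← (Fin.insertNthEquiv (fun _ => X) i).sum_comp, Fintype.sum_prod_type]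
  refine sum_congr rfl fun x _ => ?_
  simp_rw [← (Fin.insertNthEquiv (fun _ => Y) i).sum_comp, Fintype.sum_prod_type]
  rw [sum_comm (s := univ (α := Fin m → X))]
  refine sum_congr rfl fun y _ => ?_
  have h1 : ∀ c, P x y * (∑ x' : Fin m → X, u c x' * f (i.insertNth x x')) *
        (∑ y' : Fin m → Y, v c y' * g (i.insertNth y y')) * φ x y c
      = ∑ x' : Fin m → X, ∑ y' : Fin m → Y, (u c x' * v c y') *
        (P x y * (f (i.insertNth x x') * g (i.insertNth y y')) * φ x y c) := by
    intro c
    rw [mul_assoc (P x y), sum_mul_sum, mul_sum, sum_mul]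
    refine sum_congr rfl fun x' _ => ?_
    rw [mul_sum, sum_mul]
    exact sum_congr rfl fun y' _ => by ring
  simp only [h1]
  rw [sum_comm]
  refine sum_congr rfl fun x' _ => ?_
  rw [sum_comm]
  refine sum_congr rfl fun y' _ => ?_
  rw [sum_eq_single
    (fun j => if i.succAbove j < i then Sum.inl (x' j) else Sum.inr (y' j))]
  · have hrev : revealed i (i.insertNth x x' : Fin (m + 1) → X) (i.insertNth y y')
        = fun j => if i.succAbove j < i then Sum.inl (x' j) else Sum.inr (y' j) := by
      ext1 j
      simp [revealed]
    rw [(huv _ _ _).1 rfl]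
    simp only [Fin.insertNthEquiv, Equiv.coe_fn_mk, Fin.prod_univ_succAbove _ i,
      Fin.insertNth_apply_same, Fin.insertNth_apply_succAbove, hrev]
    ring
  · intro c _ hc
    rw [(huv _ _ _).2 hc, zero_mul]
  · simp

lemma sum_mul_sub_mean {X Y : Type*} [Fintype X] [Fintype Y] (P s : X → Y → ℝ)
    (h : ∑ x, ∑ y, P x y = 1) :
    ∑ x, ∑ y, P x y * (s x y - ∑ x', ∑ y', P x' y' * s x' y') = 0 := by
  simp only [mul_sub, sum_sub_distrib, ← sum_mul, h, one_mul, sub_self]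

/-- Resampling one question from its conditional distribution turns a sign function into a bounded
function with vanishing conditional mean. -/
lemma resampled_sign_properties {Y : Type*} [Fintype Y] (p σ : Y → ℝ) (hp : ∀ y, 0 ≤ p y)
    (hσ : ∀ y, |σ y| ≤ 1) :
    (∀ y, |σ y - ∑ y', p y' / (∑ z, p z) * σ y'| ≤ 2) ∧
      ∑ y, p y * (σ y - ∑ y', p y' / (∑ z, p z) * σ y') = 0 := by
  have hs0 : 0 ≤ ∑ z, p z := sum_nonneg fun z _ => hp z
  constructor
  · intro y
    have h1 : |∑ y', p y' / (∑ z, p z) * σ y'| ≤ 1 := by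
      calc _ ≤ ∑ y', |p y' / (∑ z, p z) * σ y'| := abs_sum_le_sum_abs _ _
        _ ≤ ∑ y', p y' / (∑ z, p z) := sum_le_sum fun y' _ => by
            rw [abs_mul, abs_of_nonneg (div_nonneg (hp _) hs0)]
            exact mul_le_of_le_one_right (div_nonneg (hp _) hs0) (hσ _)
        _ ≤ 1 := by
            rw [← sum_div]
            exact div_self_le_one _
    have h2 := abs_sub (σ y) (∑ y', p y' / (∑ z, p z) * σ y')
    linarith [hσ y]
  · rcases hs0.eq_or_lt with h | h
    · have : ∀ y, p y = 0 := fun y =>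
        (sum_eq_zero_iff_of_nonneg fun y _ => hp y).1 h.symm y (mem_univ _)
      simp [this]
    · simp only [mul_sub, sum_sub_distrib, ← sum_mul]
      rw [mul_sum, sub_eq_zero]
      refine sum_congr rfl fun y _ => ?_
      field_simp

lemma exists_conditional_stochastic {A : Type*} [Fintype A] [Nonempty A] (F : A → ℝ)
    (hF : ∀ a, 0 ≤ F a) :
    ∃ q : A → ℝ, (∀ a, 0 ≤ q a) ∧ ∑ a, q a = 1 ∧ ∀ a, (∑ a', F a') * q a = F a := by
  classical
  obtain ⟨a0⟩ := ‹Nonempty A›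
  rcases (sum_nonneg fun a _ => hF a : 0 ≤ ∑ a, F a).eq_or_lt with h | h
  · refine ⟨fun a => if a = a0 then 1 else 0, fun a => by simp only; split_ifs <;> simp,
      by simp, fun a => ?_⟩
    rw [← h, zero_mul]
    exact ((sum_eq_zero_iff_of_nonneg fun y _ => hF y).1 h.symm a (mem_univ _)).symm
  · refine ⟨fun a => F a / ∑ a', F a', fun a => div_nonneg (hF a) h.le, ?_, fun a => ?_⟩
    · rw [← sum_div, div_self h.ne']
    · field_simp

lemma sum_revealed_answers {X Y A B : Type*} [Fintype X] [Fintype Y] [Fintype A] [Fintype B]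
    [DecidableEq A] [DecidableEq B] (P : X → Y → ℝ) {m : ℕ} (i : Fin (m + 1))
    (u : (Fin m → X ⊕ Y) → (Fin m → X) → ℝ) (v : (Fin m → X ⊕ Y) → (Fin m → Y) → ℝ)
    (huv : ∀ c x y,
      (c = (fun j => if i.succAbove j < i then Sum.inl (x j) else Sum.inr (y j)) →
          u c x * v c y = ∏ j, P (x j) (y j)) ∧
        (c ≠ (fun j => if i.succAbove j < i then Sum.inl (x j) else Sum.inr (y j)) →
          u c x * v c y = 0))
    (f : (Fin (m + 1) → X) → ℝ) (g : (Fin (m + 1) → Y) → ℝ)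
    (a : (Fin (m + 1) → X) → A) (b : (Fin (m + 1) → Y) → B) (W : X → Y → A → B → ℝ) :
    ∑ x, ∑ y, ∑ c, ∑ d, ∑ e,
        P x y * (∑ x' : Fin m → X, u c x' * (f (i.insertNth x x') *
          if a (i.insertNth x x') = d then 1 else 0)) *
        (∑ y' : Fin m → Y, v c y' * (g (i.insertNth y y') *
          if b (i.insertNth y y') = e then 1 else 0)) * W x y d e
      = ∑ x : Fin (m + 1) → X, ∑ y : Fin (m + 1) → Y,
          (∏ j, P (x j) (y j)) * (f x * g y) * W (x i) (y i) (a x) (b y) := by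
  have e2 : ∀ ψ : X → Y → (Fin m → X ⊕ Y) → A → B → ℝ, ∑ x, ∑ y, ∑ c, ∑ d, ∑ e, ψ x y c d e
      = ∑ z : A × B, ∑ x, ∑ y, ∑ c, ψ x y c z.1 z.2 := by
    intro ψ
    have e1 : ∀ x y c, ∑ d, ∑ e, ψ x y c d e = ∑ z : A × B, ψ x y c z.1 z.2 := fun x y c =>
      (Fintype.sum_prod_type fun z : A × B => ψ x y c z.1 z.2).symm
    simp only [e1]
    rw [sum_comm (s := univ (α := A × B))]
    refine sum_congr rfl fun x _ => ?_
    rw [sum_comm (s := univ (α := A × B))]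
    exact sum_congr rfl fun y _ => sum_comm
  have e3 : ∀ ψ : (Fin (m + 1) → X) → (Fin (m + 1) → Y) → A × B → ℝ,
      ∑ z, ∑ x, ∑ y, ψ x y z = ∑ x, ∑ y, ∑ z, ψ x y z := by
    intro ψ
    rw [sum_comm (s := univ (α := A × B))]
    exact sum_congr rfl fun x _ => sum_comm
  rw [e2]
  rw [sum_congr rfl fun z _ => sum_revealed P i u v huv (fun x => f x * if a x = z.1 then 1 else 0)
    (fun y => g y * if b y = z.2 then 1 else 0) (fun x y _ => W x y z.1 z.2)]
  rw [e3]
  refine sum_congr rfl fun x _ => sum_congr rfl fun y _ => ?_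
  rw [sum_eq_single (a x, b y) _ (by simp)]
  · simp
  · rintro ⟨d, e⟩ _ hz
    rcases eq_or_ne (a x) d with rfl | hd
    · have : b y ≠ e := fun h => hz (by rw [h])
      simp [this]
    · simp [hd]

set_option maxHeartbeats 1000000 in
/-- Embedding the game in coordinate `i`: the tilted winning probability in that coordinate is at
most the value of the game, up to the tilted means of bounded, conditionally centred increments. -/
lemma coordinate_win_le {X Y A B : Type*} [Fintype X] [Fintype Y] [Fintype A] [Fintype B]
    [Nonempty A] [Nonempty B] (P : X → Y → ℝ) (hP : ∀ x y, 0 ≤ P x y)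
    (hP1 : ∑ x, ∑ y, P x y = 1) (V : X → Y → A → B → Bool) (M : ℝ) (hM0 : 0 ≤ M)
    (hM : ∀ (a : X → A) (b : Y → B),
      ∑ x, ∑ y, P x y * (if V x y (a x) (b y) then 1 else 0) ≤ M)
    {m : ℕ} (i : Fin (m + 1)) (f : (Fin (m + 1) → X) → ℝ) (g : (Fin (m + 1) → Y) → ℝ)
    (hf : ∀ x, 0 ≤ f x) (hg : ∀ y, 0 ≤ g y)
    (a : (Fin (m + 1) → X) → A) (b : (Fin (m + 1) → Y) → B) :
    ∃ (tA tB : (Fin (m + 1) → X) → (Fin (m + 1) → Y) → ℝ) (tC : X → Y → ℝ),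
      (∀ x y, |tA x y| ≤ 2) ∧ (∀ x y, |tB x y| ≤ 2) ∧ (∀ x y, |tC x y| ≤ 2) ∧
      (∀ x y y', (∀ j, i ≤ j → y j = y' j) → tA x y = tA x y') ∧
      (∀ x y, ∑ v, P (x i) v * tA x (Function.update y i v) = 0) ∧
      (∀ y x x', (∀ j, j ≤ i → x j = x' j) → tB x y = tB x' y) ∧
      (∀ y x, ∑ v, P v (y i) * tB (Function.update x i v) y = 0) ∧
      (∑ x, ∑ y, P x y * tC x y = 0) ∧
      ∑ x, ∑ y, (∏ j, P (x j) (y j)) * (f x * g y) *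
          (if V (x i) (y i) (a x) (b y) then 1 else 0) ≤
        (∑ x, ∑ y, (∏ j, P (x j) (y j)) * (f x * g y)) * M
        + 2 * ∑ x, ∑ y, (∏ j, P (x j) (y j)) * (f x * g y) * tA x y
        + 2 * ∑ x, ∑ y, (∏ j, P (x j) (y j)) * (f x * g y) * tB x y
        + ∑ x, ∑ y, (∏ j, P (x j) (y j)) * (f x * g y) * tC (x i) (y i) := by
  classical
  obtain ⟨u, v, hu, hv, huv⟩ := exists_revealed_factorization P hP i
  have hrev := sum_revealed P i u v huv
  set F : X → (Fin m → X ⊕ Y) → A → ℝ := fun x c e =>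
    ∑ x' : Fin m → X, u c x' * (f (i.insertNth x x') *
      if a (i.insertNth x x') = e then 1 else 0) with hF
  set G : Y → (Fin m → X ⊕ Y) → B → ℝ := fun y c e =>
    ∑ y' : Fin m → Y, v c y' * (g (i.insertNth y y') *
      if b (i.insertNth y y') = e then 1 else 0) with hG
  have hF0 : ∀ x c e, 0 ≤ F x c e := fun x c e => sum_nonneg fun x' _ =>
    mul_nonneg (hu _ _) (mul_nonneg (hf _) (by split_ifs <;> simp))
  have hG0 : ∀ x c e, 0 ≤ G x c e := fun x c e => sum_nonneg fun x' _ =>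
    mul_nonneg (hv _ _) (mul_nonneg (hg _) (by split_ifs <;> simp))
  have hFs : ∀ x c, ∑ e, F x c e = ∑ x' : Fin m → X, u c x' * f (i.insertNth x x') := by
    intro x c
    simp only [hF]
    rw [sum_comm]
    simp
  have hGs : ∀ y c, ∑ e, G y c e = ∑ y' : Fin m → Y, v c y' * g (i.insertNth y y') := by
    intro y c
    simp only [hG]
    rw [sum_comm]
    simp
  set μ : X → Y → (Fin m → X ⊕ Y) → ℝ := fun x y c =>
    P x y * (∑ e, F x c e) * (∑ e, G y c e) with hμ
  have hμ0 : ∀ x y c, 0 ≤ μ x y c := fun x y c =>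
    mul_nonneg (mul_nonneg (hP _ _) (sum_nonneg fun e _ => hF0 _ _ _))
      (sum_nonneg fun e _ => hG0 _ _ _)
  have hμrev : ∀ φ : X → Y → (Fin m → X ⊕ Y) → ℝ, ∑ x, ∑ y, ∑ c, μ x y c * φ x y c
      = ∑ x : Fin (m + 1) → X, ∑ y : Fin (m + 1) → Y,
          (∏ j, P (x j) (y j)) * (f x * g y) * φ (x i) (y i) (revealed i x y) := by
    intro φ
    rw [← hrev]
    simp only [hμ, hFs, hGs]
  have hμsum : ∑ x, ∑ y, ∑ c, μ x y c = ∑ x : Fin (m + 1) → X, ∑ y : Fin (m + 1) → Y,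
          (∏ j, P (x j) (y j)) * (f x * g y) := by
    simpa using hμrev fun _ _ _ => 1
  choose q hq0 hq1 hq using fun c x => exists_conditional_stochastic (F x c) (hF0 x c)
  choose r hr0 hr1 hr using fun c y => exists_conditional_stochastic (G y c) (hG0 y c)
  set κ : X → Y → (Fin m → X ⊕ Y) → ℝ := fun x y c =>
    ∑ d, ∑ e, q c x d * r c y e * (if V x y d e then 1 else 0) with hκ
  have hκ0 : ∀ x y c, 0 ≤ κ x y c := fun x y c => sum_nonneg fun d _ => sum_nonneg fun e _ =>
    mul_nonneg (mul_nonneg (hq0 _ _ _) (hr0 _ _ _)) (by split_ifs <;> simp)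
  have hκ1 : ∀ x y c, κ x y c ≤ 1 := by
    intro x y c
    calc κ x y c ≤ ∑ d, ∑ e, q c x d * r c y e := sum_le_sum fun d _ => sum_le_sum fun e _ =>
          mul_le_of_le_one_right (mul_nonneg (hq0 _ _ _) (hr0 _ _ _)) (by split_ifs <;> simp)
      _ = 1 := by rw [← sum_mul_sum, hq1, hr1, one_mul]
  set PX : X → ℝ := fun x => ∑ y, P x y with hPX
  set PY : Y → ℝ := fun y => ∑ x, P x y with hPY
  have hPX0 : ∀ x, 0 ≤ PX x := fun x => sum_nonneg fun y _ => hP _ _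
  have hPY0 : ∀ y, 0 ≤ PY y := fun y => sum_nonneg fun x _ => hP _ _
  set α : X → (Fin m → X ⊕ Y) → ℝ := fun x c => (∑ y, μ x y c) / PX x with hα
  set β : Y → (Fin m → X ⊕ Y) → ℝ := fun y c => (∑ x, μ x y c) / PY y with hβ
  have hα0 : ∀ x c, 0 ≤ α x c := fun x c => div_nonneg (sum_nonneg fun y _ => hμ0 _ _ _) (hPX0 _)
  have hβ0 : ∀ y c, 0 ≤ β y c := fun y c => div_nonneg (sum_nonneg fun x _ => hμ0 _ _ _) (hPY0 _)
  have hcs := correlated_sampling_min_max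
    (fun x y d e => P x y * (if V x y d e then 1 else 0))
    (fun x y d e => mul_nonneg (hP _ _) (by split_ifs <;> simp)) M hM0 hM α hα0 β hβ0
    q hq0 hq1 r hr0 hr1
  have hpay := payoff_le_of_min_max P hP μ κ hκ0 hκ1 α hα0 β hβ0 M
    (∑ x, ∑ y, ∑ c, μ x y c)
    (sum_nonneg fun x _ => sum_nonneg fun y _ => sum_nonneg fun c _ => hμ0 _ _ _) (by
      refine le_of_eq_of_le (sum_congr rfl fun x _ => sum_congr rfl fun y _ => ?_) hcs
      rw [← mul_div_assoc, mul_sum]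
      congr 1
      refine sum_congr rfl fun c _ => ?_
      simp only [hκ, mul_sum]
      refine sum_congr rfl fun d _ => sum_congr rfl fun e _ => ?_
      ring)
  have hwin : ∑ x, ∑ y, ∑ c, μ x y c * κ x y c
      = ∑ x : Fin (m + 1) → X, ∑ y : Fin (m + 1) → Y, (∏ j, P (x j) (y j)) * (f x * g y) *
          (if V (x i) (y i) (a x) (b y) then 1 else 0) := by
    rw [← sum_revealed_answers P i u v huv f g a b fun x y d e => if V x y d e then 1 else 0]
    refine sum_congr rfl fun x _ => sum_congr rfl fun y _ => sum_congr rfl fun c _ => ?_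
    simp only [hκ, mul_sum (s := univ (α := A)), mul_sum (s := univ (α := B))]
    refine sum_congr rfl fun d _ => sum_congr rfl fun e _ => ?_
    change _ = P x y * F x c d * G y c e * _
    rw [← hq c x d, ← hr c y e]
    simp only [hμ]
    ring
  obtain ⟨σA, hσA, hA⟩ := exists_sign_sum_abs μ (fun x y => P x y / PX x)
  obtain ⟨σB, hσB, hB⟩ := exists_sign_sum_abs (fun y x => μ x y) (fun y x => P x y / PY y)
  obtain ⟨σC, hσC, hC⟩ := exists_sign_sum_abs_marginal μ P
  have hA' : ∑ x, ∑ y, ∑ c, |μ x y c - P x y * α x c|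
      = ∑ x, ∑ y, ∑ c, |μ x y c - P x y / PX x * ∑ y', μ x y' c| := by
    simp only [hα, mul_div_assoc', div_mul_eq_mul_div]
  have hB' : ∑ x, ∑ y, ∑ c, |μ x y c - P x y * β y c|
      = ∑ y, ∑ x, ∑ c, |μ x y c - P x y / PY y * ∑ x', μ x' y c| := by
    rw [sum_comm]
    simp only [hβ, mul_div_assoc', div_mul_eq_mul_div]
  rw [hA', hB', hA, hB, hC, sum_comm (s := univ (α := Y)), hwin, hμrev, hμrev, hμrev, hμsum]
    at hpay
  have pA := fun x c => resampled_sign_properties (P x) (fun y => σA x y c) (hP x)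
    (fun y => hσA x y c)
  have pB := fun y c => resampled_sign_properties (fun x => P x y) (fun x => σB y x c)
    (fun x => hP x y) (fun x => hσB y x c)
  have hinr : ∀ (j : Fin (m + 1)) (y : Fin (m + 1) → Y) v, i < j →
      Function.update y i v j = y j := fun j y v hj => Function.update_of_ne hj.ne' _ _
  have hinl : ∀ (j : Fin (m + 1)) (x : Fin (m + 1) → X) v, j < i →
      Function.update x i v j = x j := fun j y v hj => Function.update_of_ne hj.ne _ _
  refine ⟨fun x y => σA (x i) (y i) (revealed i x y)
      - ∑ y', P (x i) y' / PX (x i) * σA (x i) y' (revealed i x y),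
    fun x y => σB (y i) (x i) (revealed i x y)
      - ∑ x', P x' (y i) / PY (y i) * σB (y i) x' (revealed i x y),
    fun x y => σC x y - ∑ x', ∑ y', P x' y' * σC x' y',
    ?_, ?_, ?_, ?_, ?_, ?_, ?_, ?_, hpay⟩
  · exact fun x y => (pA (x i) (revealed i x y)).1 (y i)
  · exact fun x y => (pB (y i) (revealed i x y)).1 (x i)
  · intro x y
    have h1 : |∑ x', ∑ y', P x' y' * σC x' y'| ≤ 1 := by
      rw [← hP1]
      refine (abs_sum_le_sum_abs _ _).trans (sum_le_sum fun x _ => ?_)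
      refine (abs_sum_le_sum_abs _ _).trans (sum_le_sum fun y _ => ?_)
      rw [abs_mul, abs_of_nonneg (hP _ _)]
      exact mul_le_of_le_one_right (hP _ _) (hσC _ _)
    have h2 := abs_sub (σC x y) (∑ x', ∑ y', P x' y' * σC x' y')
    linarith [hσC x y]
  · intro x y y' h
    simp only
    rw [revealed_congr_right i x y y' fun j hj => h j hj.le, h i le_rfl]
  · intro x y
    simp only [revealed_congr_right i x _ y fun j hj => hinr j y _ hj, Function.update_self]
    exact (pA (x i) (revealed i x y)).2
  · intro y x x' h
    simp only
    rw [revealed_congr_left i x x' y fun j hj => h j hj.le, h i le_rfl]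
  · intro y x
    simp only [revealed_congr_left i _ x y fun j hj => hinl j x _ hj, Function.update_self]
    exact (pB (y i) (revealed i x y)).2
  · exact sum_mul_sub_mean P σC hP1

lemma sum_sum_prod_eq_pow {X Y : Type*} [Fintype X] [Fintype Y] (Q : X → Y → ℝ) (m : ℕ) :
    ∑ x : Fin m → X, ∑ y : Fin m → Y, ∏ j, Q (x j) (y j) = (∑ x, ∑ y, Q x y) ^ m := by
  classical
  have h : ∀ x : Fin m → X, ∑ y : Fin m → Y, ∏ j, Q (x j) (y j) = ∏ j, ∑ y, Q (x j) y := by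
    intro x
    rw [prod_univ_sum, Fintype.piFinset_univ]
  simp only [h]
  rw [← Fintype.piFinset_univ, ← prod_univ_sum (fun _ : Fin m => (univ : Finset X))
    fun _ x => ∑ y, Q x y]
  simp

/-- A product of events of not too small probability contains a coordinate whose conditional
winning probability is bounded away from one. -/
lemma exists_coordinate_win_le {X Y A B : Type*} [Fintype X] [Fintype Y] [Fintype A] [Fintype B]
    [Nonempty A] [Nonempty B] (P : X → Y → ℝ) (hP : ∀ x y, 0 ≤ P x y)
    (hP1 : ∑ x, ∑ y, P x y = 1) (V : X → Y → A → B → Bool) (ε : ℝ) (hε0 : 0 < ε)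
    (hε1 : ε ≤ 1 / 2)
    (hM : ∀ (a : X → A) (b : Y → B),
      ∑ x, ∑ y, P x y * (if V x y (a x) (b y) then 1 else 0) ≤ 1 - ε)
    {m : ℕ} (f : (Fin (m + 1) → X) → ℝ) (g : (Fin (m + 1) → Y) → ℝ)
    (hf : ∀ x, 0 ≤ f x) (hf1 : ∀ x, f x ≤ 1) (hg : ∀ y, 0 ≤ g y) (hg1 : ∀ y, g y ≤ 1)
    (a : (Fin (m + 1) → X) → Fin (m + 1) → A) (b : (Fin (m + 1) → Y) → Fin (m + 1) → B)
    (hp : Real.exp (-(ε ^ 2 / 3200 * ((m + 1 : ℕ) : ℝ))) ≤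
      ∑ x, ∑ y, (∏ j, P (x j) (y j)) * (f x * g y)) :
    ∃ i, ∑ x, ∑ y, (∏ j, P (x j) (y j)) * (f x * g y) *
        (if V (x i) (y i) (a x i) (b y i) then 1 else 0) ≤
      (1 - ε / 2) * ∑ x, ∑ y, (∏ j, P (x j) (y j)) * (f x * g y) := by
  choose tA tB tC hA2 hB2 hC2 hAd hA0 hBd hB0 hC0 hwin using fun i : Fin (m + 1) =>
    coordinate_win_le P hP hP1 V (1 - ε) (by linarith) hM i f g hf hg
      (fun x => a x i) (fun y => b y i)
  set p := ∑ x, ∑ y, (∏ j, P (x j) (y j)) * (f x * g y) with hpdef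
  have hone : ∑ x : Fin (m + 1) → X, ∑ y : Fin (m + 1) → Y, ∏ j, P (x j) (y j) = 1 := by
    rw [sum_sum_prod_eq_pow, hP1, one_pow]
  have tilt : ∀ t : Fin (m + 1) → (Fin (m + 1) → X) → (Fin (m + 1) → Y) → ℝ,
      (∀ i x y, |t i x y| ≤ 2) →
      (∑ x, ∑ y, (∏ j, P (x j) (y j)) * ∏ i, (1 + ε / 160 * t i x y) ≤ 1) →
      ∑ i, ∑ x, ∑ y, (∏ j, P (x j) (y j)) * (f x * g y) * t i x y ≤
        p * (((m + 1 : ℕ) : ℝ) * (ε / 10)) := by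
    intro t ht hmean
    have key := sum_tilted_le (Ω := (Fin (m + 1) → X) × (Fin (m + 1) → Y))
      (fun ω => ∏ j, P (ω.1 j) (ω.2 j)) (fun ω => f ω.1 * g ω.2)
      (fun ω => prod_nonneg fun _ _ => hP _ _) (fun ω => mul_nonneg (hf _) (hg _))
      (fun ω => mul_le_one₀ (hf1 _) (hg _) (hg1 _)) (fun i ω => t i ω.1 ω.2)
      (fun i ω => ht i _ _) (ε / 160) (by positivity) (by linarith)
      (by rw [Fintype.sum_prod_type]; exact hmean) (ε ^ 2 / 3200)
      (by rw [Fintype.sum_prod_type]; exact hp)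
    simp only [Fintype.sum_prod_type] at key
    have he : ε ^ 2 / 3200 / (ε / 160) + 8 * (ε / 160) = ε / 10 := by
      field_simp; ring
    rw [he] at key
    exact key
  have kA := tilt tA hA2 (by
    refine le_of_eq (Eq.trans (sum_congr rfl fun x _ => ?_) hone)
    rw [sum_prod_one_add_martingale_ge (m + 1) (fun j v => P (x j) v)
      (fun i y => ε / 160 * tA i x y) (fun i y y' h => by rw [hAd i x y y' h])
      (fun i y => by
        simp only [mul_left_comm _ (ε / 160), ← mul_sum]
        rw [hA0, mul_zero])]
    rw [prod_univ_sum, Fintype.piFinset_univ])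
  have kB := tilt tB hB2 (by
    refine le_of_eq (Eq.trans ?_ hone)
    rw [sum_comm, sum_comm (s := univ (α := Fin (m + 1) → X))]
    refine (sum_congr rfl fun y _ => ?_)
    rw [sum_prod_one_add_martingale_le (m + 1) (fun j v => P v (y j))
      (fun i x => ε / 160 * tB i x y) (fun i x x' h => by rw [hBd i y x x' h])
      (fun i x => by
        simp only [mul_left_comm _ (ε / 160), ← mul_sum]
        rw [hB0, mul_zero])]
    rw [prod_univ_sum, Fintype.piFinset_univ])
  have kC := tilt (fun i x y => tC i (x i) (y i)) (fun i x y => hC2 i _ _) (by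
    simp only [← prod_mul_distrib]
    have h : ∀ x : Fin (m + 1) → X,
        ∑ y : Fin (m + 1) → Y, ∏ i, P (x i) (y i) * (1 + ε / 160 * tC i (x i) (y i)) =
        ∏ i, ∑ y, P (x i) y * (1 + ε / 160 * tC i (x i) y) := by
      intro x
      rw [prod_univ_sum, Fintype.piFinset_univ]
    simp only [h]
    rw [← Fintype.piFinset_univ, ← prod_univ_sum (fun _ : Fin (m + 1) => (univ : Finset X))
      fun i x => ∑ y, P x y * (1 + ε / 160 * tC i x y)]
    refine le_of_eq (prod_eq_one fun i _ => ?_)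
    simp only [mul_add, mul_one, sum_add_distrib, mul_left_comm _ (ε / 160), ← mul_sum]
    rw [hC0, hP1, mul_zero, add_zero])
  obtain ⟨i, -, hi⟩ := exists_le_of_sum_le (s := (univ : Finset (Fin (m + 1)))) univ_nonempty
    (f := fun i => ∑ x, ∑ y, (∏ j, P (x j) (y j)) * (f x * g y) *
        (if V (x i) (y i) (a x i) (b y i) then 1 else 0))
    (g := fun _ => (1 - ε / 2) * p) (by
      refine (sum_le_sum fun i _ => hwin i).trans ?_
      simp only [sum_add_distrib, ← mul_sum]
      simp only [sum_const, card_univ, Fintype.card_fin, nsmul_eq_mul]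
      linarith)
  exact ⟨i, hi⟩

lemma sum_insertNth {Z : Type*} [Fintype Z] {m : ℕ} (i : Fin (m + 1))
    (H : (Fin (m + 1) → Z) → ℝ) :
    ∑ z, H z = ∑ w, ∑ z' : Fin m → Z, H (i.insertNth w z') := by
  rw [← (Fin.insertNthEquiv (fun _ => Z) i).sum_comp, Fintype.sum_prod_type]
  rfl

lemma sum_sum_insertNth {X Y : Type*} [Fintype X] [Fintype Y] {m : ℕ} (i : Fin (m + 1))
    (F : (Fin (m + 1) → X) → (Fin (m + 1) → Y) → ℝ) :
    ∑ x, ∑ y, F x y = ∑ u, ∑ v, ∑ x' : Fin m → X, ∑ y' : Fin m → Y,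
      F (i.insertNth u x') (i.insertNth v y') := by
  rw [sum_insertNth i]
  refine sum_congr rfl fun u _ => ?_
  simp only [fun x' => sum_insertNth i (F (i.insertNth u x'))]
  exact sum_comm

lemma sum_answers_split {X Y A B : Type*} [Fintype X] [Fintype Y] [Fintype A] [Fintype B]
    [DecidableEq A] [DecidableEq B] (T : X → Y → ℝ) (f : X → ℝ) (g : Y → ℝ) (a : X → A)
    (b : Y → B) (w : A → B → ℝ) :
    ∑ d, ∑ e, w d e * ∑ x, ∑ y, T x y *
        ((f x * if a x = d then 1 else 0) * (g y * if b y = e then 1 else 0)) =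
      ∑ x, ∑ y, T x y * (f x * g y) * w (a x) (b y) := by
  simp only [mul_sum]
  calc _ = ∑ d, ∑ x, ∑ e, ∑ y, w d e * (T x y *
        ((f x * if a x = d then 1 else 0) * (g y * if b y = e then 1 else 0))) :=
        sum_congr rfl fun d _ => sum_comm
    _ = ∑ x, ∑ d, ∑ e, ∑ y, w d e * (T x y *
        ((f x * if a x = d then 1 else 0) * (g y * if b y = e then 1 else 0))) := sum_comm
    _ = ∑ x, ∑ d, ∑ y, ∑ e, w d e * (T x y *
        ((f x * if a x = d then 1 else 0) * (g y * if b y = e then 1 else 0))) :=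
        sum_congr rfl fun x _ => sum_congr rfl fun d _ => sum_comm
    _ = ∑ x, ∑ y, ∑ d, ∑ e, w d e * (T x y *
        ((f x * if a x = d then 1 else 0) * (g y * if b y = e then 1 else 0))) :=
        sum_congr rfl fun x _ => sum_comm
    _ = _ := by
      refine sum_congr rfl fun x _ => sum_congr rfl fun y _ => ?_
      simp
      ring

open Classical in
/-- Conditioning on successive coordinates which are hard to win: each step costs a factor
`|A| |B|` in the error term. -/
lemma win_all_le {X Y A B : Type*} [Fintype X] [Fintype Y] [Fintype A] [Fintype B]
    [Nonempty A] [Nonempty B] (P : X → Y → ℝ) (hP : ∀ x y, 0 ≤ P x y)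
    (hP1 : ∑ x, ∑ y, P x y = 1) (V : X → Y → A → B → Bool) (ε : ℝ) (hε0 : 0 < ε)
    (hε1 : ε ≤ 1 / 2)
    (hM : ∀ (a : X → A) (b : Y → B),
      ∑ x, ∑ y, P x y * (if V x y (a x) (b y) then 1 else 0) ≤ 1 - ε) (k : ℕ) :
    ∀ (m : ℕ) (_ : k ≤ m) (f : (Fin m → X) → ℝ) (g : (Fin m → Y) → ℝ)
      (_ : ∀ x, 0 ≤ f x) (_ : ∀ x, f x ≤ 1) (_ : ∀ y, 0 ≤ g y) (_ : ∀ y, g y ≤ 1)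
      (a : (Fin m → X) → Fin m → A) (b : (Fin m → Y) → Fin m → B),
      ∑ x, ∑ y, (∏ j, P (x j) (y j)) * (f x * g y) *
          (if ∀ i, V (x i) (y i) (a x i) (b y i) then 1 else 0) ≤
        (1 - ε / 2) ^ k * ∑ x, ∑ y, (∏ j, P (x j) (y j)) * (f x * g y) +
          ((Fintype.card A : ℝ) * (Fintype.card B : ℝ)) ^ k *
            Real.exp (-(ε ^ 2 / 3200 * ((m : ℝ) - k))) := by
  set N := (Fintype.card A : ℝ) * (Fintype.card B : ℝ) with hN
  have hN1 : 1 ≤ N := one_le_mul_of_one_le_of_one_le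
    (by exact_mod_cast Fintype.card_pos) (by exact_mod_cast Fintype.card_pos)
  have hμ : ∀ {m : ℕ} (f : (Fin m → X) → ℝ) (g : (Fin m → Y) → ℝ) (_ : ∀ x, 0 ≤ f x)
      (_ : ∀ y, 0 ≤ g y) x y, 0 ≤ (∏ j, P (x j) (y j)) * (f x * g y) := fun f g hf hg x y =>
    mul_nonneg (prod_nonneg fun _ _ => hP _ _) (mul_nonneg (hf _) (hg _))
  have hwin : ∀ {m : ℕ} (f : (Fin m → X) → ℝ) (g : (Fin m → Y) → ℝ) (_ : ∀ x, 0 ≤ f x)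
      (_ : ∀ y, 0 ≤ g y) (a : (Fin m → X) → Fin m → A) (b : (Fin m → Y) → Fin m → B),
      ∑ x, ∑ y, (∏ j, P (x j) (y j)) * (f x * g y) *
          (if ∀ i, V (x i) (y i) (a x i) (b y i) then 1 else 0) ≤
        ∑ x, ∑ y, (∏ j, P (x j) (y j)) * (f x * g y) := fun f g hf hg a b =>
    sum_le_sum fun x _ => sum_le_sum fun y _ =>
      mul_le_of_le_one_right (hμ f g hf hg x y) (by split_ifs <;> simp)
  induction k with
  | zero =>
    intro m _ f g hf _ hg _ a b
    have h := hwin f g hf hg a b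
    have h' := Real.exp_pos (-(ε ^ 2 / 3200 * ((m : ℝ) - (0 : ℕ))))
    simp only [pow_zero, one_mul]
    linarith
  | succ k ih =>
    intro m hkm f g hf hf1 hg hg1 a b
    obtain ⟨m, rfl⟩ : ∃ m', m = m' + 1 := ⟨m - 1, by omega⟩
    have hkm' : k ≤ m := by omega
    set p := ∑ x, ∑ y, (∏ j, P (x j) (y j)) * (f x * g y) with hpdef
    have hp0 : 0 ≤ p := sum_nonneg fun x _ => sum_nonneg fun y _ => hμ f g hf hg x y
    have hcast : ((m + 1 : ℕ) : ℝ) - ((k + 1 : ℕ) : ℝ) = (m : ℝ) - k := by push_cast; ring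
    rw [hcast]
    set E := Real.exp (-(ε ^ 2 / 3200 * ((m : ℝ) - k))) with hE
    have hE0 : 0 < E := Real.exp_pos _
    rcases lt_or_ge p E with hpE | hpE
    · refine (hwin f g hf hg a b).trans ?_
      have h1 : 0 ≤ (1 - ε / 2) ^ (k + 1) * p := mul_nonneg (pow_nonneg (by linarith) _) hp0
      have h2 : 1 * E ≤ N ^ (k + 1) * E :=
        mul_le_mul_of_nonneg_right (one_le_pow₀ hN1) hE0.le
      linarith
    · obtain ⟨i, hi⟩ := exists_coordinate_win_le P hP hP1 V ε hε0 hε1 hM f g hf hf1 hg hg1 a b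
        (by
          refine le_trans (Real.exp_le_exp.2 ?_) hpE
          refine neg_le_neg (mul_le_mul_of_nonneg_left ?_ (by positivity))
          push_cast
          have : (0 : ℝ) ≤ k := Nat.cast_nonneg k
          linarith)
      have hstep : ∀ u v, ∑ x' : Fin m → X, ∑ y' : Fin m → Y,
          (∏ j, P ((i.insertNth u x' : Fin (m + 1) → X) j)
              ((i.insertNth v y' : Fin (m + 1) → Y) j)) *
            (f (i.insertNth u x') * g (i.insertNth v y')) *
            (if ∀ l, V ((i.insertNth u x' : Fin (m + 1) → X) l)
              ((i.insertNth v y' : Fin (m + 1) → Y) l)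
              (a (i.insertNth u x') l) (b (i.insertNth v y') l) then 1 else 0) ≤
          (1 - ε / 2) ^ k * ∑ x' : Fin m → X, ∑ y' : Fin m → Y,
          (∏ j, P ((i.insertNth u x' : Fin (m + 1) → X) j)
              ((i.insertNth v y' : Fin (m + 1) → Y) j)) *
            (f (i.insertNth u x') * g (i.insertNth v y')) *
            (if V ((i.insertNth u x' : Fin (m + 1) → X) i)
              ((i.insertNth v y' : Fin (m + 1) → Y) i)
              (a (i.insertNth u x') i) (b (i.insertNth v y') i) then 1 else 0) +
          P u v * (N ^ (k + 1) * E) := by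
        intro u v
        have hind : ∀ (q : Prop) [Decidable q], 0 ≤ (if q then (1 : ℝ) else 0) ∧
            (if q then (1 : ℝ) else 0) ≤ 1 := fun q _ => by split_ifs <;> simp
        have key : ∀ d e, _ := fun d e => ih m hkm'
          (fun x' => f (i.insertNth u x') * if a (i.insertNth u x') i = d then 1 else 0)
          (fun y' => g (i.insertNth v y') * if b (i.insertNth v y') i = e then 1 else 0)
          (fun x' => mul_nonneg (hf _) (hind _).1)
          (fun x' => mul_le_one₀ (hf1 _) (hind _).1 (hind _).2)
          (fun y' => mul_nonneg (hg _) (hind _).1)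
          (fun y' => mul_le_one₀ (hg1 _) (hind _).1 (hind _).2)
          (fun x' j => a (i.insertNth u x') (i.succAbove j))
          (fun y' j => b (i.insertNth v y') (i.succAbove j))
        have hsum := sum_le_sum fun d (_ : d ∈ (univ : Finset A)) =>
          sum_le_sum fun e (_ : e ∈ (univ : Finset B)) =>
          mul_le_mul_of_nonneg_left (key d e) (hind (V u v d e = true)).1
        have hcomm : ∀ s t r : ℝ, s * t * r = s * r * t := fun s t r => by ring
        simp only [hcomm _ (_ * _) (ite _ _ _)] at hsum
        rw [sum_answers_split] at hsum
        simp only [mul_add, sum_add_distrib, mul_left_comm _ ((1 - ε / 2) ^ k), ← mul_sum] at hsum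
        rw [sum_answers_split] at hsum
        have hcard : ∑ d : A, ∑ e : B, (if V u v d e then (1 : ℝ) else 0) * (N ^ k * E) ≤
            N * (N ^ k * E) := by
          calc _ ≤ ∑ d : A, ∑ e : B, (N ^ k * E) := sum_le_sum fun d _ => sum_le_sum fun e _ =>
                mul_le_of_le_one_left (by positivity) (hind _).2
            _ = N * (N ^ k * E) := by
              simp only [sum_const, card_univ, nsmul_eq_mul, hN]; ring
        have hfin := mul_le_mul_of_nonneg_left (hsum.trans (add_le_add_right hcard _)) (hP u v)
        rw [mul_add, mul_left_comm (P u v)] at hfin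
        simp only [mul_sum] at hfin ⊢
        simp only [Fin.prod_univ_succAbove _ i, Fin.forall_iff_succAbove i,
          Fin.insertNth_apply_same, Fin.insertNth_apply_succAbove]
        refine (le_of_eq ?_).trans (hfin.trans (le_of_eq ?_))
        · refine sum_congr rfl fun x _ => sum_congr rfl fun y _ => ?_
          by_cases h1 : V u v (a (i.insertNth u x) i) (b (i.insertNth v y) i) = true
          · simp only [h1, true_and, if_true, mul_one]
            ring
          · simp [h1]
        · refine congrArg₂ (· + ·) ?_ (by ring)
          refine sum_congr rfl fun x _ => sum_congr rfl fun y _ => ?_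
          ring
      rw [sum_sum_insertNth i]
      rw [sum_sum_insertNth i] at hi
      refine (sum_le_sum fun u _ => sum_le_sum fun v _ => hstep u v).trans ?_
      have h := mul_le_mul_of_nonneg_left hi
        (pow_nonneg (by linarith : (0 : ℝ) ≤ 1 - ε / 2) k)
      rw [← mul_assoc, ← pow_succ] at h
      simp only [sum_add_distrib, ← mul_sum, ← sum_mul]
      rw [hP1, one_mul]
      exact add_le_add h le_rfl

open Classical in
lemma win_all_le_single {X Y A B : Type*} [Fintype X] [Fintype Y] (P : X → Y → ℝ)
    (hP : ∀ x y, 0 ≤ P x y) (hP1 : ∑ x, ∑ y, P x y = 1) (V : X → Y → A → B → Bool) (M : ℝ)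
    (hM : ∀ (a : X → A) (b : Y → B),
      ∑ x, ∑ y, P x y * (if V x y (a x) (b y) then 1 else 0) ≤ M) {m : ℕ}
    (a : (Fin (m + 1) → X) → Fin (m + 1) → A) (b : (Fin (m + 1) → Y) → Fin (m + 1) → B) :
    ∑ x, ∑ y, (∏ j, P (x j) (y j)) *
        (if ∀ i, V (x i) (y i) (a x i) (b y i) then 1 else 0) ≤ M := by
  rw [sum_sum_insertNth 0]
  calc _ ≤ ∑ u, ∑ v, ∑ x' : Fin m → X, ∑ y' : Fin m → Y, (∏ j, P (x' j) (y' j)) *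
        (P u v * if V u v (a ((0 : Fin (m + 1)).insertNth u x') 0)
          (b ((0 : Fin (m + 1)).insertNth v y') 0) then 1 else 0) := by
        refine sum_le_sum fun u _ => sum_le_sum fun v _ => sum_le_sum fun x' _ =>
          sum_le_sum fun y' _ => ?_
        rw [Fin.prod_univ_succAbove _ 0]
        simp only [Fin.insertNth_apply_same, Fin.insertNth_apply_succAbove]
        rw [mul_comm (P u v), mul_assoc]
        refine mul_le_mul_of_nonneg_left (mul_le_mul_of_nonneg_left ?_ (hP u v))
          (prod_nonneg fun _ _ => hP _ _)
        by_cases h : ∀ i, V ((0 : Fin (m + 1)).insertNth (α := fun _ => X) u x' i)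
            ((0 : Fin (m + 1)).insertNth (α := fun _ => Y) v y' i)
            (a ((0 : Fin (m + 1)).insertNth u x') i)
            (b ((0 : Fin (m + 1)).insertNth v y') i) = true
        · have h0 := h 0
          simp only [Fin.insertNth_apply_same] at h0
          rw [if_pos h, if_pos h0]
        · rw [if_neg h]
          split_ifs <;> simp
    _ = ∑ x' : Fin m → X, ∑ y' : Fin m → Y, (∏ j, P (x' j) (y' j)) *
        ∑ u, ∑ v, P u v * if V u v (a ((0 : Fin (m + 1)).insertNth u x') 0)
          (b ((0 : Fin (m + 1)).insertNth v y') 0) then 1 else 0 := by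
        simp only [mul_sum]
        rw [sum_congr rfl fun u _ => sum_comm, sum_comm]
        refine sum_congr rfl fun x' _ => ?_
        rw [sum_congr rfl fun u _ => sum_comm, sum_comm]
    _ ≤ ∑ x' : Fin m → X, ∑ y' : Fin m → Y, (∏ j, P (x' j) (y' j)) * M :=
        sum_le_sum fun x' _ => sum_le_sum fun y' _ => mul_le_mul_of_nonneg_left
          (hM (fun u => a ((0 : Fin (m + 1)).insertNth u x') 0)
            fun v => b ((0 : Fin (m + 1)).insertNth v y') 0) (prod_nonneg fun _ _ => hP _ _)
    _ = M := by
        simp only [← sum_mul]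
        rw [sum_sum_prod_eq_pow, hP1, one_pow, one_mul]

lemma le_one_sub_rpow_of_le_pow_add (ε W N : ℝ) (hε0 : 0 < ε) (hε1 : ε ≤ 1 / 2) (hN : 1 ≤ N)
    (n : ℕ) (hW : W ≤ 1 - ε)
    (hk : ∀ k : ℕ, k ≤ n →
      W ≤ (1 - ε / 2) ^ k + N ^ k * Real.exp (-(ε ^ 2 / 3200 * ((n : ℝ) - k)))) :
    W ≤ (1 - ε ^ (4 : ℝ)) ^ (1 / 128000 * (n : ℝ) / (Real.logb 2 N + 1)) := by
  set s := Real.logb 2 N + 1 with hs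
  have hs1 : 1 ≤ s := by
    have := Real.logb_nonneg (b := 2) (by norm_num) hN
    linarith
  have hs0 : 0 < s := by linarith
  have hlogN : Real.log N ≤ s := by
    have h0 : 0 ≤ Real.logb 2 N := Real.logb_nonneg (by norm_num) hN
    have h1 : Real.log N = Real.logb 2 N * Real.log 2 := by
      rw [Real.logb, div_mul_cancel₀ _ (Real.log_pos (by norm_num)).ne']
    have h2 : Real.log 2 ≤ 1 := by linarith [Real.log_two_lt_d9]
    rw [h1]
    nlinarith
  have hn0 : (0 : ℝ) ≤ n := Nat.cast_nonneg n
  have hδ1 : ε ^ 2 / 3200 ≤ 1 := by nlinarith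
  have hδ0 : 0 < ε ^ 2 / 3200 := by positivity
  set δ := ε ^ 2 / 3200 with hδ
  set z := δ * n / (4 * s) with hz
  have hz0 : 0 ≤ z := by positivity
  have hzs : z * s = δ * n / 4 := by
    rw [hz]
    field_simp
  have hzn : z ≤ n / 4 := by
    rw [hz, div_le_div_iff₀ (by positivity) (by norm_num)]
    nlinarith [mul_le_mul hδ1 hs1 zero_le_one zero_le_one, mul_nonneg hn0 (sub_nonneg.2 hs1),
      mul_nonneg hn0 (sub_nonneg.2 hδ1)]
  have hexp : W ≤ Real.exp (-(ε ^ 2 * z / 5)) := by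
    rcases lt_or_ge z (5 / ε) with hzε | hzε
    · have h1 : z * ε < 5 := (lt_div_iff₀ hε0).1 hzε
      calc W ≤ 1 - ε := hW
        _ ≤ Real.exp (-ε) := by linarith [Real.add_one_le_exp (-ε)]
        _ ≤ _ := Real.exp_le_exp.2 (by nlinarith)
    · have h1 : 5 ≤ z * ε := (div_le_iff₀ hε0).1 hzε
      have hkz : (⌊z⌋₊ : ℝ) ≤ z := Nat.floor_le hz0
      have hkz' : z - 1 ≤ (⌊z⌋₊ : ℝ) := by linarith [Nat.lt_floor_add_one z]
      have hkn : ⌊z⌋₊ ≤ n := by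
        have : (⌊z⌋₊ : ℝ) ≤ n := by linarith
        exact_mod_cast this
      have hW' := hk _ hkn
      have hfirst : (1 - ε / 2) ^ ⌊z⌋₊ ≤ Real.exp (-(ε * (z - 1) / 2)) := by
        calc (1 - ε / 2) ^ ⌊z⌋₊ ≤ Real.exp (-(ε / 2)) ^ ⌊z⌋₊ :=
              pow_le_pow_left₀ (by linarith) (by linarith [Real.add_one_le_exp (-(ε / 2))]) _
          _ = Real.exp (⌊z⌋₊ * -(ε / 2)) := (Real.exp_nat_mul _ _).symm
          _ ≤ _ := Real.exp_le_exp.2 (by nlinarith)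
      have hsecond : N ^ ⌊z⌋₊ * Real.exp (-(δ * ((n : ℝ) - ⌊z⌋₊))) ≤
          Real.exp (-(ε * (z - 1) / 2)) := by
        have hpow : N ^ ⌊z⌋₊ = Real.exp (⌊z⌋₊ * Real.log N) := by
          rw [Real.exp_nat_mul, Real.exp_log (by linarith)]
        rw [hpow, ← Real.exp_add]
        refine Real.exp_le_exp.2 ?_
        have e1 : (⌊z⌋₊ : ℝ) * Real.log N ≤ z * s :=
          mul_le_mul hkz hlogN (Real.log_nonneg hN) hz0
        have e2 : δ * (⌊z⌋₊ : ℝ) ≤ δ * (n / 4) :=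
          mul_le_mul_of_nonneg_left (by linarith) hδ0.le
        have e3 : z ≤ z * s := le_mul_of_one_le_right hz0 hs1
        nlinarith
      have htwo : (2 : ℝ) ≤ Real.exp 1 := by linarith [Real.add_one_le_exp (1 : ℝ)]
      calc W ≤ 2 * Real.exp (-(ε * (z - 1) / 2)) := by linarith
        _ ≤ Real.exp 1 * Real.exp (-(ε * (z - 1) / 2)) :=
            mul_le_mul_of_nonneg_right htwo (Real.exp_pos _).le
        _ = Real.exp (1 + -(ε * (z - 1) / 2)) := (Real.exp_add _ _).symm
        _ ≤ _ := Real.exp_le_exp.2 (by nlinarith)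
  have hw : ε ^ (4 : ℝ) = ε ^ 4 := by exact_mod_cast Real.rpow_natCast ε 4
  have hw1 : ε ^ 4 ≤ 1 / 2 :=
    (pow_le_pow_left₀ hε0.le hε1 4).trans (by norm_num)
  have hw0 : 0 < ε ^ 4 := by positivity
  rw [hw, Real.rpow_def_of_pos (by linarith)]
  refine hexp.trans (Real.exp_le_exp.2 ?_)
  have hlog : -(2 * ε ^ 4) ≤ Real.log (1 - ε ^ 4) := by
    refine le_trans ?_ (Real.one_sub_inv_le_log_of_pos (by linarith))
    have h : (1 - ε ^ 4)⁻¹ ≤ 1 + 2 * ε ^ 4 := by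
      rw [inv_le_iff_one_le_mul₀ (by linarith)]
      nlinarith
    linarith
  calc -(ε ^ 2 * z / 5) = -(2 * ε ^ 4) * (1 / 128000 * n / s) := by
        rw [hz, hδ]
        field_simp
        ring
    _ ≤ _ := mul_le_mul_of_nonneg_right hlog (by positivity)

/-- The parallel repetition theorem of Raz and Holenstein: there are universal
constants `c, c' > 0` such that for every two-player non-local game `G` with
classical value `1 − ε` (`0 < ε ≤ 1/2`), the classical value of the `n`-fold
parallel repetition `G^{⊗n}` is at most `(1 − ε^c)^(c'·n/s)` where
`s = log₂(|A|·|B|) + 1`.  The classical value being `1 − ε` is expressed by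
saying that every deterministic strategy wins with probability at most `1 − ε`
and some deterministic strategy attains `1 − ε`. -/
theorem parallel_repetition :
    ∃ c c' : ℝ, 0 < c ∧ 0 < c' ∧
      ∀ (X Y A B : Type) [Fintype X] [Fintype Y] [Fintype A] [Fintype B]
        (P : X → Y → ℝ),
        (∀ x y, 0 ≤ P x y) → (∑ x, ∑ y, P x y = 1) →
        ∀ (V : X → Y → A → B → Bool) (ε : ℝ), 0 < ε → ε ≤ 1 / 2 →
        (∀ (a : X → A) (b : Y → B),
          ∑ x, ∑ y, P x y * (if V x y (a x) (b y) then 1 else 0) ≤ 1 - ε) →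
        (∃ (a : X → A) (b : Y → B),
          ∑ x, ∑ y, P x y * (if V x y (a x) (b y) then 1 else 0) = 1 - ε) →
        ∀ n : ℕ, 0 < n →
        ∀ (an : (Fin n → X) → Fin n → A) (bn : (Fin n → Y) → Fin n → B),
          (∑ x : Fin n → X, ∑ y : Fin n → Y, (∏ i, P (x i) (y i)) *
              (if ∀ i, V (x i) (y i) (an x i) (bn y i) then 1 else 0)) ≤
            (1 - ε ^ c) ^
              (c' * n / (Real.logb 2 ((Fintype.card A : ℝ) * (Fintype.card B : ℝ)) + 1)) := by
  refine ⟨4, 1 / 128000, by norm_num, by norm_num, ?_⟩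
  intro X Y A B _ _ _ _ P hP hP1 V ε hε0 hε1 hM ⟨a₀, b₀, _⟩ n hn an bn
  obtain ⟨x₀, -, hx₀⟩ := exists_ne_zero_of_sum_ne_zero (hP1.trans_ne one_ne_zero)
  obtain ⟨y₀, -, -⟩ := exists_ne_zero_of_sum_ne_zero hx₀
  have : Nonempty A := ⟨a₀ x₀⟩
  have : Nonempty B := ⟨b₀ y₀⟩
  refine le_one_sub_rpow_of_le_pow_add ε _ _ hε0 hε1 (one_le_mul_of_one_le_of_one_le
    (by exact_mod_cast Fintype.card_pos) (by exact_mod_cast Fintype.card_pos)) n ?_ ?_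
  · obtain ⟨m, rfl⟩ : ∃ m, n = m + 1 := ⟨n - 1, by omega⟩
    convert win_all_le_single P hP hP1 V (1 - ε) hM an bn
  · intro k hk
    have h := win_all_le P hP hP1 V ε hε0 hε1 hM k n hk (fun _ => 1) (fun _ => 1)
      (fun _ => zero_le_one) (fun _ => le_rfl) (fun _ => zero_le_one) (fun _ => le_rfl) an bn
    simp only [mul_one] at h
    rw [sum_sum_prod_eq_pow, hP1, one_pow, mul_one] at h
    convert h
end

section
/- For every pair of functions a : {1,2,3} → {0,1}³ and b : {1,2,3} → {0,1}³, the number of pairs (x,y) ∈ {1,2,3} × {1,2,3} such that a(x)₁ ⊕ a(x)₂ ⊕ a(x)₃ = 0, b(y)₁ ⊕ b(y)₂ ⊕ b(y)₃ = 1, and a(x)_y = b(y)_x is at most 8. Equivalently, the classical value of the magic square game is at most 8/9. -/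
/-- The classical value of the magic square game is at most `8/9`: for every
deterministic strategy (row assignments `a` and column assignments `b`), at
most 8 of the 9 question pairs `(x, y)` are won, where winning means `a x` has
even parity, `b y` has odd parity, and the intersection entries agree. -/
theorem magic_square_classical_value
    (a b : Fin 3 → Fin 3 → Bool) :
    (Finset.univ.filter (fun p : Fin 3 × Fin 3 =>
        xor (a p.1 0) (xor (a p.1 1) (a p.1 2)) = false ∧
        xor (b p.2 0) (xor (b p.2 1) (b p.2 2)) = true ∧
        a p.1 p.2 = b p.2 p.1)).card ≤ 8 := by
  by_contra h
  have hle := Finset.card_filter_le (Finset.univ : Finset (Fin 3 × Fin 3)) (fun p =>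
    xor (a p.1 0) (xor (a p.1 1) (a p.1 2)) = false ∧
    xor (b p.2 0) (xor (b p.2 1) (b p.2 2)) = true ∧ a p.1 p.2 = b p.2 p.1)
  have hcard : (Finset.univ : Finset (Fin 3 × Fin 3)).card = 9 := by simp
  have hwin := Finset.card_filter_eq_iff.mp (le_antisymm hle (by omega))
  have hrow (x : Fin 3) : xor (a x 0) (xor (a x 1) (a x 2)) = false :=
    (hwin (x, 0) (Finset.mem_univ _)).1
  have hcol (y : Fin 3) : xor (a 0 y) (xor (a 1 y) (a 2 y)) = true := by
    have hb := (hwin (0, y) (Finset.mem_univ _)).2.1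
    have hab (x : Fin 3) : a x y = b y x := (hwin (x, y) (Finset.mem_univ _)).2.2
    rw [hab, hab, hab]
    exact hb
  -- Summing all entries by rows gives even parity, by columns odd parity.
  have hsum : xor (xor (a 0 0) (xor (a 0 1) (a 0 2)))
        (xor (xor (a 1 0) (xor (a 1 1) (a 1 2))) (xor (a 2 0) (xor (a 2 1) (a 2 2)))) =
      xor (xor (a 0 0) (xor (a 1 0) (a 2 0)))
        (xor (xor (a 0 1) (xor (a 1 1) (a 2 1))) (xor (a 0 2) (xor (a 1 2) (a 2 2)))) := by
    simp only [Bool.xor_comm, Bool.xor_left_comm]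
  simp only [hrow, hcol] at hsum
  exact absurd hsum (by decide)
end

section
/- There exists a constant c > 0 such that for every positive integer n, the classical value of G^{⊗n}, the n-fold parallel repetition of the magic square game G, is at most 2^{−cn}. That is, for all functions a : {1,2,3}^n → ({0,1}³)^n and b : {1,2,3}^n → ({0,1}³)^n, the probability over uniformly random (x,y) ∈ {1,2,3}^n × {1,2,3}^n that the magic square winning condition holds in every coordinate i ∈ {1,…,n} is at most 2^{−cn}. -/
/-- The magic square game has no perfect deterministic strategy. -/
theorem not_exists_perfect_magic_square (A B : Fin 3 → Fin 3 → Bool)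
    (hA : ∀ s, xor (A s 0) (xor (A s 1) (A s 2)) = false)
    (hB : ∀ t, xor (B t 0) (xor (B t 1) (B t 2)) = true)
    (hAB : ∀ s t, A s t = B t s) : False := by
  have parity : ∀ p q r s t u v w x : Bool,
      xor p (xor q r) = false → xor s (xor t u) = false → xor v (xor w x) = false →
      xor p (xor s v) = true → xor q (xor t w) = true → xor r (xor u x) = true → False := by
    decide
  simp only [← hAB] at hB
  exact parity _ _ _ _ _ _ _ _ _ (hA 0) (hA 1) (hA 2) (hB 0) (hB 1) (hB 2)

/-- Counting stars: a power-mean bound on the number of tuples with a common neighbour. -/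
theorem pow_sum_le_card_pow_mul_sum_prod {α β : Type*} [Fintype α] [Fintype β] [Nonempty α]
    (f : α → β → ℝ) (hf : ∀ x y, 0 ≤ f x y) (k : ℕ) :
    (∑ x, ∑ y, f x y) ^ (k + 1) ≤
      (Fintype.card α : ℝ) ^ k * ∑ v : Fin (k + 1) → β, ∑ x, ∏ t, f x (v t) := by
  have h := pow_sum_div_card_le_sum_pow (s := Finset.univ) (f := fun x => ∑ y, f x y)
    (fun x _ => Finset.sum_nonneg fun y _ => hf x y) k
  have hc : (0 : ℝ) < (Fintype.card α : ℝ) ^ k := by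
    have : 0 < Fintype.card α := Fintype.card_pos
    positivity
  rw [Finset.card_univ, div_le_iff₀' hc] at h
  refine h.trans_eq ?_
  simp only [Fintype.sum_pow]
  rw [Finset.sum_comm]

/-- Counting complete bipartite subgraphs: a weighted bipartite graph has at least as many copies
of `K_{k+1,m+1}` as a random one of the same density. -/
theorem pow_sum_le_card_pow_mul_sum_prod_prod {α β : Type*} [Fintype α] [Fintype β]
    [Nonempty α] [Nonempty β] (f : α → β → ℝ) (hf : ∀ x y, 0 ≤ f x y) (k m : ℕ) :
    (∑ x, ∑ y, f x y) ^ ((k + 1) * (m + 1)) ≤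
      (Fintype.card α : ℝ) ^ (k * (m + 1)) * (Fintype.card β : ℝ) ^ ((k + 1) * m) *
        ∑ u : Fin (m + 1) → α, ∑ v : Fin (k + 1) → β, ∏ s, ∏ t, f (u s) (v t) := by
  have h := pow_sum_le_card_pow_mul_sum_prod (fun (v : Fin (k + 1) → β) x => ∏ t, f x (v t))
    (fun v x => Finset.prod_nonneg fun t _ => hf x (v t)) m
  rw [Fintype.card_fun, Fintype.card_fin, Nat.cast_pow, ← pow_mul] at h
  calc (∑ x, ∑ y, f x y) ^ ((k + 1) * (m + 1))
      ≤ ((Fintype.card α : ℝ) ^ k * ∑ v : Fin (k + 1) → β, ∑ x, ∏ t, f x (v t)) ^ (m + 1) := by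
        rw [pow_mul]
        exact pow_le_pow_left₀
          (pow_nonneg (Finset.sum_nonneg fun x _ => Finset.sum_nonneg fun y _ => hf x y) _)
          (pow_sum_le_card_pow_mul_sum_prod f hf k) _
    _ ≤ _ := by
        rw [mul_pow, ← pow_mul, mul_assoc]
        exact mul_le_mul_of_nonneg_left h (by positivity)

/-- The number of pairs of triples of questions in which no coordinate shows every question of
each player in order. -/
theorem card_pairs_without_identity_coordinate (n : ℕ) :
    (Finset.univ.filter (fun q : (Fin 3 → Fin n → Fin 3) × (Fin 3 → Fin n → Fin 3) =>
      ¬ ∃ i, ∀ s, q.1 s i = s ∧ q.2 s i = s)).card ≤ 728 ^ n := by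
  let T : Finset ((Fin 3 → Fin 3) × (Fin 3 → Fin 3)) := Finset.univ.erase (id, id)
  have hT : T.card = 728 := by simp [T, Finset.card_erase_of_mem]
  have hcard : (Fintype.piFinset fun _ : Fin n => T).card = 728 ^ n := by
    simp [Fintype.card_piFinset, hT]
  rw [← hcard]
  refine Finset.card_le_card_of_injOn (fun q i => (fun s => q.1 s i, fun s => q.2 s i)) ?_ ?_
  · intro q hq
    have hq := (Finset.mem_filter.mp hq).2
    simp only [Finset.mem_coe, Fintype.mem_piFinset]
    intro i
    refine Finset.mem_erase.mpr ⟨fun h => hq ⟨i, fun s => ?_⟩, Finset.mem_univ _⟩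
    rw [Prod.mk.injEq] at h
    exact ⟨congrFun h.1 s, congrFun h.2 s⟩
  · intro p _ q _ h
    ext s i : 3
    · exact congrFun (congrArg Prod.fst (congrFun h i)) s
    · exact congrFun (congrArg Prod.snd (congrFun h i)) s

/-- Exponential-decay parallel repetition for the magic square game: there is a
constant `c > 0` such that for every `n ≥ 1` and every deterministic strategy
`(a, b)` for the `n`-fold parallel repetition, the probability over uniformly
random questions `(x, y) ∈ {1,2,3}^n × {1,2,3}^n` of winning all `n`
coordinates is at most `2^{−cn}`. -/
theorem magic_square_parallel_repetition :
    ∃ c : ℝ, 0 < c ∧ ∀ n : ℕ, 0 < n →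
      ∀ (a : (Fin n → Fin 3) → Fin n → Fin 3 → Bool)
        (b : (Fin n → Fin 3) → Fin n → Fin 3 → Bool),
        ((Finset.univ.filter (fun p : (Fin n → Fin 3) × (Fin n → Fin 3) =>
            ∀ i : Fin n,
              xor (a p.1 i 0) (xor (a p.1 i 1) (a p.1 i 2)) = false ∧
              xor (b p.2 i 0) (xor (b p.2 i 1) (b p.2 i 2)) = true ∧
              a p.1 i (p.2 i) = b p.2 i (p.1 i))).card : ℝ) / (9 : ℝ) ^ n ≤
          (2 : ℝ) ^ (-(c * n)) := by
  refine ⟨Real.logb 2 (729 / 728) / 9,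
    div_pos (Real.logb_pos (by norm_num) (by norm_num)) (by norm_num), fun n _ a b => ?_⟩
  set W := Finset.univ.filter (fun p : (Fin n → Fin 3) × (Fin n → Fin 3) =>
            ∀ i : Fin n,
              xor (a p.1 i 0) (xor (a p.1 i 1) (a p.1 i 2)) = false ∧
              xor (b p.2 i 0) (xor (b p.2 i 1) (b p.2 i 2)) = true ∧
              a p.1 i (p.2 i) = b p.2 i (p.1 i))
  let f : (Fin n → Fin 3) → (Fin n → Fin 3) → ℝ := fun x y => if (x, y) ∈ W then 1 else 0
  have hf_nonneg : ∀ x y, 0 ≤ f x y := fun x y => by simp only [f]; positivity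
  have hsum : ∑ x, ∑ y, f x y = W.card := by
    rw [← Fintype.sum_prod_type']
    simp [f]
  have hcount : ∑ u : Fin 3 → Fin n → Fin 3, ∑ v : Fin 3 → Fin n → Fin 3,
      ∏ s, ∏ t, f (u s) (v t) ≤ (728 : ℝ) ^ n := by
    refine le_trans ?_ (Nat.cast_le.mpr (card_pairs_without_identity_coordinate n) |>.trans
      (by simp))
    rw [← Fintype.sum_prod_type', Finset.card_filter, Nat.cast_sum]
    refine Finset.sum_le_sum fun q _ => ?_
    by_cases hq : ∃ i, ∀ s, q.1 s i = s ∧ q.2 s i = s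
    · suffices h : ∏ s, ∏ t, f (q.1 s) (q.2 t) = 0 from h.trans_le (Nat.cast_nonneg _)
      obtain ⟨i, hi⟩ := hq
      by_contra h
      have hmem : ∀ s t, (q.1 s, q.2 t) ∈ W := by
        simp only [Finset.prod_eq_zero_iff, not_exists, not_and, f] at h
        intro s t
        by_contra hst
        exact h s (Finset.mem_univ _) t (Finset.mem_univ _) (if_neg hst)
      have hwin := fun s t => (Finset.mem_filter.mp (hmem s t)).2 i
      refine not_exists_perfect_magic_square (fun s => a (q.1 s) i) (fun t => b (q.2 t) i)
        (fun s => (hwin s 0).1) (fun t => (hwin 0 t).2.1) fun s t => ?_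
      simpa [(hi s).1, (hi t).2] using (hwin s t).2.2
    · rw [if_pos hq, Nat.cast_one]
      exact Finset.prod_le_one (fun s _ => Finset.prod_nonneg fun t _ => hf_nonneg _ _)
        fun s _ => Finset.prod_le_one (fun t _ => hf_nonneg _ _)
          fun t _ => by simp only [f]; split_ifs <;> norm_num
  have hmain := pow_sum_le_card_pow_mul_sum_prod_prod f hf_nonneg 2 2
  simp only [Nat.reduceAdd, Nat.reduceMul, hsum, Fintype.card_fun, Fintype.card_fin,
    Nat.cast_pow, Nat.cast_ofNat] at hmain
  refine le_of_pow_le_pow_left₀ (n := 9) (by norm_num) (by positivity) ?_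
  have hright : ((2 : ℝ) ^ (-(Real.logb 2 (729 / 728) / 9 * n))) ^ 9 = (728 / 729) ^ n := by
    rw [← Real.rpow_natCast, ← Real.rpow_mul (by norm_num),
      show -(Real.logb 2 (729 / 728) / 9 * n) * ((9 : ℕ) : ℝ) = Real.logb 2 (729 / 728) * -(n : ℝ) by
        push_cast; ring,
      Real.rpow_mul (by norm_num), Real.rpow_logb (by norm_num) (by norm_num) (by norm_num),
      Real.rpow_neg (by norm_num), Real.rpow_natCast, ← inv_pow]
    norm_num
  rw [hright, div_pow, div_le_iff₀ (by positivity)]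
  calc (W.card : ℝ) ^ 9 ≤ _ := hmain
    _ ≤ ((3 : ℝ) ^ n) ^ 6 * ((3 : ℝ) ^ n) ^ 6 * 728 ^ n :=
      mul_le_mul_of_nonneg_left hcount (by positivity)
    _ = (728 / 729) ^ n * ((9 : ℝ) ^ n) ^ 9 := by
      rw [pow_right_comm 3 n 6, pow_right_comm 9 n 9, ← mul_pow, ← mul_pow,
        ← mul_pow (728 / 729 : ℝ)]
      norm_num
end

section
/- There exists a constant c > 0 such that for every positive integer n the following holds: for every finite set R with a probability distribution μ on R and every randomized strategy given by functions a : {1,2,3}^n × R → ({0,1}³)^n and b : {1,2,3}^n × R → ({0,1}³)^n, the probability over r ~ μ and uniformly random (x,y) ∈ {1,2,3}^n × {1,2,3}^n that the magic square winning condition holds in every coordinate (with answers a(x,r) and b(y,r)) is at most 2^{−cn}. In other words, every zero-communication strategy with shared randomness for the n-fold parallel repetition of the magic square game succeeds with probability at most 2^{−cn}. -/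
/-- Sidorenko's inequality for `K_{k+1,k+1}`: the number of homomorphisms from the complete
bipartite graph to a nonnegative weighted bipartite graph is at least its random expectation. -/
theorem pow_sum_div_card_le_sum_prod {X : Type*} [Fintype X] (k : ℕ)
    (f : X → X → ℝ) (hf : ∀ x y, 0 ≤ f x y) :
    ((∑ y, ∑ x, f x y) ^ (k + 1) / (Fintype.card X : ℝ) ^ k) ^ (k + 1) /
        ((Fintype.card X : ℝ) ^ (k + 1)) ^ k ≤
      ∑ u : Fin (k + 1) → X, ∑ v : Fin (k + 1) → X, ∏ j, ∏ i, f (u i) (v j) := by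
  have h₁ : (∑ y, ∑ x, f x y) ^ (k + 1) / (Fintype.card X : ℝ) ^ k ≤
      ∑ u : Fin (k + 1) → X, ∑ y, ∏ i, f (u i) y := by
    conv_rhs => rw [Finset.sum_comm]
    rw [← Finset.sum_congr rfl fun y _ ↦ Fintype.sum_pow (f · y) (k + 1)]
    exact pow_sum_div_card_le_sum_pow (fun y _ ↦ Finset.sum_nonneg fun x _ ↦ hf x y) k
  have h₂ := pow_sum_div_card_le_sum_pow (s := (Finset.univ : Finset (Fin (k + 1) → X)))
    (f := fun u ↦ ∑ y, ∏ i, f (u i) y) (n := k)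
    fun u _ ↦ Finset.sum_nonneg fun y _ ↦ Finset.prod_nonneg fun i _ ↦ hf (u i) y
  have hS : 0 ≤ ∑ y, ∑ x, f x y :=
    Finset.sum_nonneg fun y _ ↦ Finset.sum_nonneg fun x _ ↦ hf x y
  rw [← Finset.sum_congr rfl fun (u : Fin (k + 1) → X) _ ↦
    Fintype.sum_pow (fun y ↦ ∏ i, f (u i) y) (k + 1)]
  refine le_trans ?_ h₂
  rw [Finset.card_univ, Fintype.card_pi_const, Nat.cast_pow]
  gcongr

/-- The magic square game has no perfect classical strategy. -/
theorem magic_square_no_perfect_strategy (A B : Fin 3 → Fin 3 → Bool)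
    (hA : ∀ j, xor (A j 0) (xor (A j 1) (A j 2)) = false)
    (hB : ∀ k, xor (B k 0) (xor (B k 1) (B k 2)) = true)
    (hAB : ∀ j k, A j k = B k j) : False := by
  have hA₀ := hA 0
  have hA₁ := hA 1
  have hA₂ := hA 2
  have hB₀ := hB 0
  have hB₁ := hB 1
  have hB₂ := hB 2
  simp only [hAB] at hA₀ hA₁ hA₂
  clear hA hB hAB
  generalize B 0 0 = b₀₀, B 0 1 = b₀₁, B 0 2 = b₀₂, B 1 0 = b₁₀, B 1 1 = b₁₁, B 1 2 = b₁₂,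
    B 2 0 = b₂₀, B 2 1 = b₂₁, B 2 2 = b₂₂ at *
  revert b₀₀ b₀₁ b₀₂ b₁₀ b₁₁ b₁₂ b₂₀ b₂₁ b₂₂
  decide

/-- The number of pairs of triples in `[3]^n` that restrict to the full question grid
in no coordinate. -/
theorem card_forall_ne_grid (n : ℕ) :
    (Finset.univ.filter (fun w : (Fin 3 → Fin n → Fin 3) × (Fin 3 → Fin n → Fin 3) ↦
      ∀ i, ¬ ((∀ j, w.1 j i = j) ∧ ∀ k, w.2 k i = k))).card ≤ 728 ^ n := by
  have hcard : Fintype.card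
      (Fin n → {q : (Fin 3 → Fin 3) × (Fin 3 → Fin 3) // q ≠ (id, id)}) = 728 ^ n := by
    simp [Fintype.card_subtype_compl]
  rw [← Fintype.card_subtype, ← hcard]
  refine Fintype.card_le_of_injective
    (fun w i ↦ ⟨(fun j ↦ w.1.1 j i, fun k ↦ w.1.2 k i), fun h ↦ w.2 i ?_⟩) ?_
  · rw [Prod.mk.injEq] at h
    exact ⟨congr_fun h.1, congr_fun h.2⟩
  · intro w w' h
    have h' i := Prod.mk.inj (congr_arg Subtype.val (congr_fun h i))
    exact Subtype.ext (Prod.ext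
      (funext fun j ↦ funext fun i ↦ congr_fun (h' i).1 j)
      (funext fun j ↦ funext fun i ↦ congr_fun (h' i).2 j))

/-- A set of question pairs whose complete `3 × 3` subgrids never restrict to the full question
grid of a coordinate has exponentially small density. -/
theorem density_pow_nine_le (n : ℕ) (W : (Fin n → Fin 3) × (Fin n → Fin 3) → Prop)
    [DecidablePred W]
    (hW : ∀ u v : Fin 3 → Fin n → Fin 3, (∀ j k, W (u j, v k)) →
      ∀ i, ¬ ((∀ j, u j i = j) ∧ ∀ k, v k i = k)) :
    (((Finset.univ.filter W).card : ℝ) / 9 ^ n) ^ 9 ≤ (728 / 729) ^ n := by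
  have h := pow_sum_div_card_le_sum_prod 2 (fun x y ↦ if W (x, y) then (1 : ℝ) else 0)
    fun x y ↦ by split_ifs <;> norm_num
  have hS : ∑ y, ∑ x, (if W (x, y) then (1 : ℝ) else 0) = (Finset.univ.filter W).card := by
    rw [Finset.sum_comm, ← Fintype.sum_prod_type' (f := fun x y ↦ if W (x, y) then (1 : ℝ) else 0),
      Finset.sum_boole]
  have hT : ∑ u : Fin 3 → Fin n → Fin 3, ∑ v : Fin 3 → Fin n → Fin 3,
      ∏ k, ∏ j, (if W (u j, v k) then (1 : ℝ) else 0) ≤ 728 ^ n := by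
    rw [← Fintype.sum_prod_type' (f := fun (u v : Fin 3 → Fin n → Fin 3) ↦
      ∏ k, ∏ j, (if W (u j, v k) then (1 : ℝ) else 0))]
    simp only [Finset.prod_ite_zero, Finset.prod_const_one, Finset.sum_boole]
    refine le_trans (Nat.cast_le.2 (Finset.card_le_card ?_))
      ((Nat.cast_le.2 (card_forall_ne_grid n)).trans_eq (by norm_num))
    intro w hw
    rw [Finset.mem_filter] at hw ⊢
    exact ⟨hw.1, hW w.1 w.2 fun j k ↦ hw.2 k (Finset.mem_univ k) j (Finset.mem_univ j)⟩
  replace h := h.trans hT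
  rw [hS] at h
  simp only [Fintype.card_pi_const, Fintype.card_fin, Nat.cast_pow, Nat.cast_ofNat] at h
  have h729 : (729 : ℝ) ^ n = (3 ^ n) ^ 6 := by rw [← pow_mul, mul_comm, pow_mul]; norm_num
  have h9 : (9 : ℝ) ^ n = (3 ^ n) ^ 2 := by rw [← pow_mul, mul_comm, pow_mul]; norm_num
  rw [div_pow, div_pow, h729, h9]
  have h3 : (0 : ℝ) < 3 ^ n := by positivity
  generalize (3 : ℝ) ^ n = m at *
  calc
    _ = (((Finset.univ.filter W).card : ℝ) ^ (2 + 1) / m ^ 2) ^ (2 + 1) /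
        (m ^ (2 + 1)) ^ 2 / m ^ 6 := by
      simp only [Nat.reduceAdd, div_pow]
      field_simp
    _ ≤ _ := by gcongr

/-- Every zero-communication strategy with shared randomness for the `n`-fold
parallel repetition of the magic square game succeeds with probability at most
`2^{−cn}`: there is a constant `c > 0` such that for every `n ≥ 1`, every
finite set `R` with a probability distribution `μ`, and every randomized
strategy `(a, b)` depending on the shared randomness `r`, the average over
`r ~ μ` and uniform questions of the probability of winning all coordinates is
at most `2^{−cn}`. -/
theorem magic_square_shared_randomness_parallel_repetition :
    ∃ c : ℝ, 0 < c ∧ ∀ n : ℕ, 0 < n →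
      ∀ (R : Type) [Fintype R] (μ : R → ℝ),
        (∀ r, 0 ≤ μ r) → (∑ r, μ r = 1) →
        ∀ (a : (Fin n → Fin 3) → R → Fin n → Fin 3 → Bool)
          (b : (Fin n → Fin 3) → R → Fin n → Fin 3 → Bool),
          (∑ r, μ r *
            (((Finset.univ.filter (fun p : (Fin n → Fin 3) × (Fin n → Fin 3) =>
                ∀ i : Fin n,
                  xor (a p.1 r i 0) (xor (a p.1 r i 1) (a p.1 r i 2)) = false ∧
                  xor (b p.2 r i 0) (xor (b p.2 r i 1) (b p.2 r i 2)) = true ∧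
                  a p.1 r i (p.2 i) = b p.2 r i (p.1 i))).card : ℝ) / (9 : ℝ) ^ n)) ≤
            (2 : ℝ) ^ (-(c * n)) := by
  set ρ : ℝ := 728 / 729 with hρ
  refine ⟨-Real.logb 2 ρ / 9, ?_, ?_⟩
  · have := Real.logb_neg (b := 2) (x := ρ) (by norm_num) (by norm_num [hρ]) (by norm_num [hρ])
    linarith
  intro n _ R _ μ hμ hμ1 a b
  have hpow : ((2 : ℝ) ^ (-(-Real.logb 2 ρ / 9 * n))) ^ 9 = ρ ^ n := by
    rw [← Real.rpow_natCast, ← Real.rpow_mul (by norm_num),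
      show -(-Real.logb 2 ρ / 9 * n) * ((9 : ℕ) : ℝ) = Real.logb 2 ρ * n by push_cast; ring,
      Real.rpow_mul (by norm_num), Real.rpow_logb (by norm_num) (by norm_num) (by norm_num [hρ]),
      Real.rpow_natCast]
  rw [← one_mul ((2 : ℝ) ^ _), ← hμ1, Finset.sum_mul]
  refine Finset.sum_le_sum fun r _ ↦ mul_le_mul_of_nonneg_left ?_ (hμ r)
  refine le_of_pow_le_pow_left₀ (n := 9) (by norm_num) (by positivity) ?_
  rw [hpow]
  refine density_pow_nine_le n _ fun u v huv i ⟨hu, hv⟩ ↦ ?_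
  refine magic_square_no_perfect_strategy (fun j ↦ a (u j) r i) (fun k ↦ b (v k) r i)
    (fun j ↦ (huv j 0 i).1) (fun k ↦ (huv 0 k i).2.1) fun j k ↦ ?_
  have := (huv j k i).2.2
  dsimp only at this
  rwa [hu j, hv k] at this
end

section
/- Let X, Y, Z be nonempty finite sets and F : X × Y → Z a function. Suppose there exists a family of probability distributions p(·,·|x,y) on Z × Z, indexed by (x,y) ∈ X × Y, that is no-signaling (for each x, the first marginal Σ_w p(z,w|x,y) is the same for all y, and for each y, the second marginal Σ_z p(z,w|x,y) is the same for all x), and such that for every (x,y) ∈ X × Y, the probability that both coordinates equal F(x,y), i.e., p({(z,w) : z = F(x,y) and w = F(x,y)} | x,y), is strictly greater than 1/2. Then F is constant. -/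
/-- A probability distribution has at most one outcome of probability greater than `1/2`. -/
theorem eq_of_half_lt_of_sum_eq_one {ι : Type*} [Fintype ι] {f : ι → ℝ} (hf0 : ∀ i, 0 ≤ f i)
    (hf1 : ∑ i, f i = 1) {a b : ι} (ha : 1 / 2 < f a) (hb : 1 / 2 < f b) : a = b := by
  classical
  by_contra hab
  have h : f a + f b ≤ ∑ i, f i := by
    rw [← Finset.sum_pair hab]
    exact Finset.sum_le_sum_of_subset_of_nonneg (Finset.subset_univ _) fun i _ _ => hf0 i
  linarith

/-- Two joint distributions with the same first marginal, each concentrated with probability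
greater than `1/2` on a single pair, agree on the first coordinate of that pair. -/
theorem fst_eq_of_marginal_eq {ι κ : Type*} [Fintype ι] [Fintype κ] {q r : ι → κ → ℝ}
    (hq0 : ∀ i j, 0 ≤ q i j) (hr0 : ∀ i j, 0 ≤ r i j) (hq1 : ∑ i, ∑ j, q i j = 1)
    (hqr : ∀ i, ∑ j, q i j = ∑ j, r i j) {a b : ι} {c d : κ}
    (ha : 1 / 2 < q a c) (hb : 1 / 2 < r b d) : a = b := by
  refine eq_of_half_lt_of_sum_eq_one (fun i => Finset.sum_nonneg fun j _ => hq0 i j) hq1 ?_ ?_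
  · exact ha.trans_le (Finset.single_le_sum (fun j _ => hq0 a j) (Finset.mem_univ c))
  · rw [hqr b]
    exact hb.trans_le (Finset.single_le_sum (fun j _ => hr0 b j) (Finset.mem_univ d))

/-- If a function `F : X × Y → Z` is computed with success probability strictly
greater than `1/2` (both parties outputting `F x y`) by a no-signaling family of
output distributions `p(·,·|x,y)` on `Z × Z`, then `F` is constant. -/
theorem no_signaling_function_constant
    {X Y Z : Type*} [Fintype X] [Fintype Y] [Fintype Z] [DecidableEq Z]
    [Nonempty X] [Nonempty Y] [Nonempty Z]
    (F : X → Y → Z)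
    (p : X → Y → Z → Z → ℝ)
    (hp0 : ∀ x y z w, 0 ≤ p x y z w)
    (hp1 : ∀ x y, ∑ z, ∑ w, p x y z w = 1)
    (hnsA : ∀ x y y' z, ∑ w, p x y z w = ∑ w, p x y' z w)
    (hnsB : ∀ x x' y w, ∑ z, p x y z w = ∑ z, p x' y z w)
    (hmaj : ∀ x y, p x y (F x y) (F x y) > 1 / 2) :
    ∀ x x' y y', F x y = F x' y' := by
  intro x x' y y'
  calc
    F x y = F x y' :=
      fst_eq_of_marginal_eq (hp0 x y) (hp0 x y') (hp1 x y) (hnsA x y y') (hmaj x y) (hmaj x y')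
    _ = F x' y' :=
      fst_eq_of_marginal_eq (q := fun w z => p x y' z w) (r := fun w z => p x' y' z w)
        (fun w z => hp0 x y' z w) (fun w z => hp0 x' y' z w)
        (Finset.sum_comm.trans (hp1 x y')) (hnsB x x' y') (hmaj x y') (hmaj x' y')
end

section
/- For every finite-dimensional quantum strategy for the CHSH game — that is, for all positive integers d_A, d_B, every unit vector ψ ∈ ℂ^{d_A} ⊗ ℂ^{d_B}, and all POVMs {M^x_a}_{a∈{0,1}} on ℂ^{d_A} for each x ∈ {0,1} and {N^y_b}_{b∈{0,1}} on ℂ^{d_B} for each y ∈ {0,1} — the winning probability (1/4)·Σ_{x,y∈{0,1}} Σ_{a⊕b = x∧y} ⟨ψ| (M^x_a ⊗ N^y_b) |ψ⟩ is at most (2+√2)/4. -/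
open ComplexOrder
open Matrix

/-- The value `⟨ψ| (A ⊗ B) |ψ⟩` in terms of the amplitudes of `ψ`. -/
def tensorForm {m n : Type*} [Fintype m] [Fintype n] (ψ : m → n → ℂ)
    (A : Matrix m m ℂ) (B : Matrix n n ℂ) : ℂ :=
  ∑ i, ∑ j, ∑ k, ∑ l, star (ψ i k) * A i j * B k l * ψ j l

section TensorForm

variable {m n : Type*} [Fintype m] [Fintype n] (ψ : m → n → ℂ)

lemma tensorForm_add_left (A A' : Matrix m m ℂ) (B : Matrix n n ℂ) :
    tensorForm ψ (A + A') B = tensorForm ψ A B + tensorForm ψ A' B := by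
  simp only [tensorForm, Matrix.add_apply, mul_add, add_mul, Finset.sum_add_distrib]

lemma tensorForm_sub_left (A A' : Matrix m m ℂ) (B : Matrix n n ℂ) :
    tensorForm ψ (A - A') B = tensorForm ψ A B - tensorForm ψ A' B := by
  simp only [tensorForm, Matrix.sub_apply, mul_sub, sub_mul, Finset.sum_sub_distrib]

lemma tensorForm_add_right (A : Matrix m m ℂ) (B B' : Matrix n n ℂ) :
    tensorForm ψ A (B + B') = tensorForm ψ A B + tensorForm ψ A B' := by
  simp only [tensorForm, Matrix.add_apply, mul_add, add_mul, Finset.sum_add_distrib]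

lemma tensorForm_sub_right (A : Matrix m m ℂ) (B B' : Matrix n n ℂ) :
    tensorForm ψ A (B - B') = tensorForm ψ A B - tensorForm ψ A B' := by
  simp only [tensorForm, Matrix.sub_apply, mul_sub, sub_mul, Finset.sum_sub_distrib]

lemma tensorForm_one_one [DecidableEq m] [DecidableEq n] :
    tensorForm ψ 1 1 = ((∑ i, ∑ k, Complex.normSq (ψ i k) : ℝ) : ℂ) := by
  simp [tensorForm, Matrix.one_apply, Complex.normSq_eq_conj_mul_self]

/-- For Hermitian `A`, `⟨ψ| (A ⊗ B) |ψ⟩` is the inner product of `(A ⊗ 1) ψ` and `(1 ⊗ B) ψ`. -/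
lemma tensorForm_eq_sum_star_mul {A : Matrix m m ℂ} (hA : A.IsHermitian) (B : Matrix n n ℂ) :
    tensorForm ψ A B = ∑ j, ∑ k, star ((A *ᵥ fun i => ψ i k) j) * (B *ᵥ ψ j) k := by
  rw [tensorForm, Finset.sum_comm]
  refine Finset.sum_congr rfl fun j _ => ?_
  rw [Finset.sum_comm]
  refine Finset.sum_congr rfl fun k _ => ?_
  simp only [mulVec, dotProduct, star_sum, star_mul', hA.apply, Finset.sum_mul_sum]
  refine Finset.sum_congr rfl fun i _ => Finset.sum_congr rfl fun l _ => ?_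
  ring

end TensorForm

/-- The observable of a two-outcome POVM is a contraction. -/
lemma sum_normSq_sub_mulVec_le {n : Type*} [Fintype n] [DecidableEq n] {P Q : Matrix n n ℂ}
    (hP : P.PosSemidef) (hQ : Q.PosSemidef) (hPQ : P + Q = 1) (v : n → ℂ) :
    ∑ i, Complex.normSq (((P - Q) *ᵥ v) i) ≤ ∑ i, Complex.normSq (v i) := by
  have sum_eq (w : n → ℂ) : ((∑ i, Complex.normSq (w i) : ℝ) : ℂ) = star w ⬝ᵥ w := by
    simp [dotProduct, Complex.normSq_eq_conj_mul_self]
  have hH : (P - Q)ᴴ = P - Q := (hP.isHermitian.sub hQ.isHermitian).eq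
  have psd : (P * Q * P + Q * P * Q).PosSemidef := by
    have h₁ := hQ.conjTranspose_mul_mul_same P
    have h₂ := hP.conjTranspose_mul_mul_same Q
    rw [hP.isHermitian.eq] at h₁
    rw [hQ.isHermitian.eq] at h₂
    exact h₁.add h₂
  have key : (1 : Matrix n n ℂ) - (P - Q) * (P - Q) = (4 : ℕ) • (P * Q * P + Q * P * Q) := by
    obtain rfl : Q = 1 - P := eq_sub_of_add_eq' hPQ
    noncomm_ring
  have nonneg : 0 ≤ star v ⬝ᵥ (((1 : Matrix n n ℂ) - (P - Q) * (P - Q)) *ᵥ v) := by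
    rw [key, smul_mulVec, dotProduct_smul]
    exact nsmul_nonneg (psd.dotProduct_mulVec_nonneg v) 4
  rw [sub_mulVec, one_mulVec, dotProduct_sub, sub_nonneg] at nonneg
  rw [← Complex.real_le_real, sum_eq, sum_eq, star_mulVec, hH, ← dotProduct_mulVec,
    mulVec_mulVec]
  exact nonneg

lemma chsh_re_le (u₀ u₁ v₀ v₁ : ℂ) :
    (star u₀ * v₀ + star u₀ * v₁ + star u₁ * v₀ - star u₁ * v₁).re ≤
      √2 / 2 * (Complex.normSq u₀ + Complex.normSq u₁ + Complex.normSq v₀ +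
        Complex.normSq v₁) := by
  have h2 : √2 * √2 = 2 := Real.mul_self_sqrt (by norm_num)
  have hs : 0 < √2 := by positivity
  simp only [Complex.normSq_apply, Complex.sub_re, Complex.add_re, Complex.mul_re, Complex.star_def,
    Complex.conj_re, Complex.conj_im]
  have sos : 0 ≤ (√2 * u₀.re - (v₀.re + v₁.re)) ^ 2 + (√2 * u₀.im - (v₀.im + v₁.im)) ^ 2 +
      (√2 * u₁.re - (v₀.re - v₁.re)) ^ 2 + (√2 * u₁.im - (v₀.im - v₁.im)) ^ 2 := by positivity
  refine le_of_mul_le_mul_left ?_ hs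
  linear_combination (1 / 2) * sos +
    (1 / 2) * (v₀.re ^ 2 + v₀.im ^ 2 + v₁.re ^ 2 + v₁.im ^ 2) * (-h2)

/-- Tsirelson's bound: every finite-dimensional quantum strategy for the CHSH
game — a unit vector `ψ ∈ ℂ^{d_A} ⊗ ℂ^{d_B}` (represented by its amplitudes
`ψ : Fin d_A → Fin d_B → ℂ`) together with POVMs `{M x a}` on `ℂ^{d_A}` and
`{N y b}` on `ℂ^{d_B}` — wins with probability at most `(2 + √2)/4`.  Here
`⟨ψ| (M x a ⊗ N y b) |ψ⟩ = ∑ i j k l, conj (ψ i k) * M x a i j * N y b k l * ψ j l`. -/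
theorem chsh_tsirelson_bound
    (dA dB : ℕ) (hdA : 0 < dA) (hdB : 0 < dB)
    (ψ : Fin dA → Fin dB → ℂ)
    (hψ : ∑ i, ∑ k, Complex.normSq (ψ i k) = 1)
    (M : Bool → Bool → Matrix (Fin dA) (Fin dA) ℂ)
    (N : Bool → Bool → Matrix (Fin dB) (Fin dB) ℂ)
    (hMpsd : ∀ x a, (M x a).PosSemidef)
    (hMsum : ∀ x, M x false + M x true = 1)
    (hNpsd : ∀ y b, (N y b).PosSemidef)
    (hNsum : ∀ y, N y false + N y true = 1) :
    ((1 / 4 : ℂ) * ∑ x, ∑ y, ∑ a, ∑ b,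
        (if xor a b = (x && y) then
          ∑ i, ∑ j, ∑ k, ∑ l, star (ψ i k) * M x a i j * N y b k l * ψ j l
        else 0)).re ≤ (2 + Real.sqrt 2) / 4 := by
  set A : Bool → Matrix (Fin dA) (Fin dA) ℂ := fun x => M x false - M x true with hA
  set B : Bool → Matrix (Fin dB) (Fin dB) ℂ := fun y => N y false - N y true with hB
  have hAH (x) : (A x).IsHermitian := (hMpsd x false).isHermitian.sub (hMpsd x true).isHermitian
  have expand (x y) : tensorForm ψ (A x) (B y) =
      tensorForm ψ (M x false) (N y false) - tensorForm ψ (M x false) (N y true) -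
      (tensorForm ψ (M x true) (N y false) - tensorForm ψ (M x true) (N y true)) := by
    simp only [hA, hB, tensorForm_sub_left, tensorForm_sub_right]
    ring
  have total (x y) : tensorForm ψ (M x false) (N y false) + tensorForm ψ (M x false) (N y true) +
      (tensorForm ψ (M x true) (N y false) + tensorForm ψ (M x true) (N y true)) = 1 := by
    rw [← tensorForm_add_right, ← tensorForm_add_right, ← tensorForm_add_left, hMsum, hNsum,
      tensorForm_one_one, hψ, Complex.ofReal_one]
  have hu (x) : ∑ j, ∑ k, Complex.normSq ((A x *ᵥ fun i => ψ i k) j) ≤ 1 := by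
    rw [Finset.sum_comm, ← hψ, Finset.sum_comm (f := fun i k => Complex.normSq (ψ i k))]
    exact Finset.sum_le_sum fun k _ =>
      sum_normSq_sub_mulVec_le (hMpsd x false) (hMpsd x true) (hMsum x) _
  have hv (y) : ∑ j, ∑ k, Complex.normSq ((B y *ᵥ ψ j) k) ≤ 1 := by
    rw [← hψ]
    exact Finset.sum_le_sum fun j _ =>
      sum_normSq_sub_mulVec_le (hNpsd y false) (hNpsd y true) (hNsum y) _
  have bound : (tensorForm ψ (A false) (B false) + tensorForm ψ (A false) (B true) +
      tensorForm ψ (A true) (B false) - tensorForm ψ (A true) (B true)).re ≤ 2 * √2 := by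
    simp only [tensorForm_eq_sum_star_mul ψ (hAH _), ← Finset.sum_add_distrib,
      ← Finset.sum_sub_distrib, Complex.re_sum]
    refine (Finset.sum_le_sum fun j _ => Finset.sum_le_sum fun k _ =>
      chsh_re_le _ _ _ _).trans ?_
    simp only [← Finset.mul_sum, Finset.sum_add_distrib]
    nlinarith [hu false, hu true, hv false, hv true, Real.sqrt_nonneg 2]
  have value : ((1 / 4 : ℂ) * ∑ x, ∑ y, ∑ a, ∑ b,
        (if xor a b = (x && y) then tensorForm ψ (M x a) (N y b) else 0)) =
      ((1 / 2 : ℝ) : ℂ) + ((1 / 8 : ℝ) : ℂ) *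
        (tensorForm ψ (A false) (B false) + tensorForm ψ (A false) (B true) +
          tensorForm ψ (A true) (B false) - tensorForm ψ (A true) (B true)) := by
    simp only [expand, Fintype.sum_bool]
    simp
    linear_combination (1 / 8 : ℂ) * (total false false + total false true + total true false +
      total true true)
  change ((1 / 4 : ℂ) * ∑ x, ∑ y, ∑ a, ∑ b,
        (if xor a b = (x && y) then tensorForm ψ (M x a) (N y b) else 0)).re ≤ _
  rw [value, Complex.add_re, Complex.re_ofReal_mul, Complex.ofReal_re]
  linarith
end

section
/- There exists a finite-dimensional quantum strategy for the CHSH game achieving winning probability exactly (2+√2)/4; in fact one exists with d_A = d_B = 2, with ψ the EPR state (1/√2)(|00⟩ + |11⟩) ∈ ℂ² ⊗ ℂ² and projective two-outcome measurements on each side. -/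
open ComplexOrder

/-- The projection onto the `(-1) ^ a`-eigenspace of the reflection `!![c, s; s, -c]`
(for `c ^ 2 + s ^ 2 = 1`). -/
noncomputable def reflectionProj (c s : ℝ) (a : Bool) : Matrix (Fin 2) (Fin 2) ℂ :=
  if a then !![(1 - c) / 2, -s / 2; -s / 2, (1 + c) / 2]
  else !![(1 + c) / 2, s / 2; s / 2, (1 - c) / 2]

theorem reflectionProj_false_add_true (c s : ℝ) :
    reflectionProj c s false + reflectionProj c s true = 1 := by
  ext i j
  fin_cases i <;> fin_cases j <;> simp [reflectionProj] <;> ring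

theorem reflectionProj_isHermitian (c s : ℝ) (a : Bool) :
    (reflectionProj c s a).IsHermitian := by
  ext i j
  cases a <;> fin_cases i <;> fin_cases j <;> simp [reflectionProj]

theorem reflectionProj_mul_self {c s : ℝ} (h : c ^ 2 + s ^ 2 = 1) (a : Bool) :
    reflectionProj c s a * reflectionProj c s a = reflectionProj c s a := by
  have hC : (c : ℂ) ^ 2 + (s : ℂ) ^ 2 = 1 := by exact_mod_cast h
  ext i j
  cases a <;> fin_cases i <;> fin_cases j <;>
    simp [reflectionProj, Matrix.mul_apply, Fin.sum_univ_two] <;>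
    first
    | ring1
    | linear_combination hC / 4

theorem Matrix.IsHermitian.posSemidef_of_mul_self {n : Type*} [Fintype n] {A : Matrix n n ℂ}
    (hA : A.IsHermitian) (h : A * A = A) : A.PosSemidef := by
  have := Matrix.posSemidef_conjTranspose_mul_self A
  rwa [hA.eq, h] at this

/-- Measuring `A ⊗ B` on the EPR state gives half the trace of `Aᵀ * B`. -/
theorem epr_expectation (A B : Matrix (Fin 2) (Fin 2) ℂ) (ψ : Fin 2 → Fin 2 → ℂ)
    (hψ : ψ = fun i k => if i = k then ((1 / Real.sqrt 2 : ℝ) : ℂ) else 0) :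
    ∑ i, ∑ j, ∑ k, ∑ l, star (ψ i k) * A i j * B k l * ψ j l =
      1 / 2 * ∑ i, ∑ j, A i j * B i j := by
  have h : ((1 / Real.sqrt 2 : ℝ) : ℂ) * ((1 / Real.sqrt 2 : ℝ) : ℂ) = 1 / 2 := by
    rw [← Complex.ofReal_mul, div_mul_div_comm, Real.mul_self_sqrt zero_le_two]
    norm_num
  subst hψ
  simp only [← h, Finset.mul_sum, apply_ite star, star_zero, ite_mul, mul_ite, zero_mul, mul_zero,
    Finset.sum_ite_eq, Finset.mem_univ, if_true, Complex.star_def, Complex.conj_ofReal]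
  simp only [Fin.sum_univ_two]
  simp
  ring

/-- The trace pairing of two spectral projections, in terms of the angle between the reflections. -/
theorem sum_reflectionProj_mul (c s d t : ℝ) (a b : Bool) :
    ∑ i, ∑ j, reflectionProj c s a i j * reflectionProj d t b i j =
      (1 + (if xor a b then -1 else 1) * (c * d + s * t)) / 2 := by
  cases a <;> cases b <;> simp [reflectionProj, Fin.sum_univ_two] <;> ring

/-- The CHSH game has a finite-dimensional quantum strategy achieving winning
probability exactly `(2 + √2)/4`, with `d_A = d_B = 2`, the EPR state
`(1/√2)(|00⟩ + |11⟩)` and projective two-outcome measurements on each side. -/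
theorem chsh_tsirelson_bound_attained :
    ∃ (M : Bool → Bool → Matrix (Fin 2) (Fin 2) ℂ)
      (N : Bool → Bool → Matrix (Fin 2) (Fin 2) ℂ),
      (∀ x a, (M x a).PosSemidef) ∧
      (∀ x, M x false + M x true = 1) ∧
      (∀ x a, (M x a).IsHermitian ∧ M x a * M x a = M x a) ∧
      (∀ y b, (N y b).PosSemidef) ∧
      (∀ y, N y false + N y true = 1) ∧
      (∀ y b, (N y b).IsHermitian ∧ N y b * N y b = N y b) ∧
      (let ψ : Fin 2 → Fin 2 → ℂ := fun i k =>
        if i = k then (1 / Real.sqrt 2 : ℝ) else 0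
      ((1 / 4 : ℂ) * ∑ x, ∑ y, ∑ a, ∑ b,
        (if xor a b = (x && y) then
          ∑ i, ∑ j, ∑ k, ∑ l, star (ψ i k) * M x a i j * N y b k l * ψ j l
        else 0)) = (((2 + Real.sqrt 2) / 4 : ℝ) : ℂ)) := by
  have hr : (Real.sqrt 2 / 2) ^ 2 + (Real.sqrt 2 / 2) ^ 2 = 1 := by
    rw [div_pow, Real.sq_sqrt zero_le_two]
    norm_num
  have hM (x : Bool) : (if x then (0 : ℝ) else 1) ^ 2 + (if x then (1 : ℝ) else 0) ^ 2 = 1 := by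
    cases x <;> simp
  have hN (y : Bool) : (Real.sqrt 2 / 2) ^ 2 +
      (if y then -(Real.sqrt 2 / 2) else Real.sqrt 2 / 2) ^ 2 = 1 := by
    cases y <;> simpa using hr
  refine ⟨fun x => reflectionProj (if x then 0 else 1) (if x then 1 else 0),
    fun y => reflectionProj (Real.sqrt 2 / 2)
      (if y then -(Real.sqrt 2 / 2) else Real.sqrt 2 / 2),
    fun x a => (reflectionProj_isHermitian _ _ a).posSemidef_of_mul_self
      (reflectionProj_mul_self (hM x) a),
    fun x => reflectionProj_false_add_true _ _,
    fun x a => ⟨reflectionProj_isHermitian _ _ a, reflectionProj_mul_self (hM x) a⟩,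
    fun y b => (reflectionProj_isHermitian _ _ b).posSemidef_of_mul_self
      (reflectionProj_mul_self (hN y) b),
    fun y => reflectionProj_false_add_true _ _,
    fun y b => ⟨reflectionProj_isHermitian _ _ b, reflectionProj_mul_self (hN y) b⟩, ?_⟩
  intro ψ
  simp only [epr_expectation _ _ ψ rfl, sum_reflectionProj_mul]
  simp
  ring
end

section
/- There exists a finite-dimensional quantum strategy for the magic square game with winning probability exactly 1; in fact one exists with d_A = d_B = 4, i.e., with a shared state consisting of two EPR pairs and projective measurements on each side. That is, there are a unit vector ψ ∈ ℂ⁴ ⊗ ℂ⁴ and, for each row x ∈ {1,2,3}, a POVM {M^x_a}_{a∈{0,1}³} on ℂ⁴, and for each column y ∈ {1,2,3}, a POVM {N^y_b}_{b∈{0,1}³} on ℂ⁴, such that for every question pair (x,y), the answers (a,b) produced satisfy with probability 1: the parity of a is even, the parity of b is odd, and a_y = b_x. -/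
open ComplexOrder

namespace MagicSquare

/-- Mermin's square of commuting real two-qubit observables `-XI, -IX, XX; IZ, ZI, ZZ; XZ, ZX, YY`:
each row multiplies to `1` and each column to `-1`. -/
def observable : Fin 3 → Fin 3 → Matrix (Fin 4) (Fin 4) ℤ :=
  ![![!![0, 0, -1, 0; 0, 0, 0, -1; -1, 0, 0, 0; 0, -1, 0, 0],
      !![0, -1, 0, 0; -1, 0, 0, 0; 0, 0, 0, -1; 0, 0, -1, 0],
      !![0, 0, 0, 1; 0, 0, 1, 0; 0, 1, 0, 0; 1, 0, 0, 0]],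
    ![!![1, 0, 0, 0; 0, -1, 0, 0; 0, 0, 1, 0; 0, 0, 0, -1],
      !![1, 0, 0, 0; 0, 1, 0, 0; 0, 0, -1, 0; 0, 0, 0, -1],
      !![1, 0, 0, 0; 0, -1, 0, 0; 0, 0, -1, 0; 0, 0, 0, 1]],
    ![!![0, 0, 1, 0; 0, 0, 0, -1; 1, 0, 0, 0; 0, -1, 0, 0],
      !![0, 1, 0, 0; 1, 0, 0, 0; 0, 0, 0, -1; 0, 0, -1, 0],
      !![0, 0, 0, -1; 0, 0, 1, 0; 0, 1, 0, 0; -1, 0, 0, 0]]]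

/-- Four times the joint spectral projection, at outcome `a`, of three commuting involutions `A`
whose product is `1` (`parity = false`) or `-1` (`parity = true`). -/
def scaledProjection (parity : Bool) (A : Fin 3 → Matrix (Fin 4) (Fin 4) ℤ) (a : Fin 3 → Bool) :
    Matrix (Fin 4) (Fin 4) ℤ :=
  if xor (a 0) (xor (a 1) (a 2)) = parity then 1 + ∑ i, (if a i then -A i else A i) else 0

/-- Four times Alice's projection for row `x` and answer `a`. -/
def scaledRow (x : Fin 3) : (Fin 3 → Bool) → Matrix (Fin 4) (Fin 4) ℤ :=
  scaledProjection false (observable x)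

/-- Four times Bob's projection for column `y` and answer `b`. -/
def scaledColumn (y : Fin 3) : (Fin 3 → Bool) → Matrix (Fin 4) (Fin 4) ℤ :=
  scaledProjection true fun x => observable x y

theorem scaledRow_transpose : ∀ x a, (scaledRow x a).transpose = scaledRow x a := by
  decide +kernel

theorem scaledRow_mul_self : ∀ x a, scaledRow x a * scaledRow x a = 4 • scaledRow x a := by
  decide +kernel

theorem sum_scaledRow : ∀ x, ∑ a, scaledRow x a = 4 • 1 := by
  decide +kernel

theorem scaledColumn_transpose : ∀ y b, (scaledColumn y b).transpose = scaledColumn y b := by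
  decide +kernel

theorem scaledColumn_mul_self :
    ∀ y b, scaledColumn y b * scaledColumn y b = 4 • scaledColumn y b := by
  decide +kernel

theorem sum_scaledColumn : ∀ y, ∑ b, scaledColumn y b = 4 • 1 := by
  decide +kernel

theorem sum_winning_scaled : ∀ x y : Fin 3,
    (∑ a : Fin 3 → Bool, ∑ b : Fin 3 → Bool,
      if xor (a 0) (xor (a 1) (a 2)) = false ∧
          xor (b 0) (xor (b 1) (b 2)) = true ∧ a y = b x then
        ∑ i, ∑ j, scaledRow x a i j * scaledColumn y b i j
      else 0) = 64 := by
  decide +kernel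

/-- The complex matrix `K / 4`. -/
noncomputable def quarter (K : Matrix (Fin 4) (Fin 4) ℤ) : Matrix (Fin 4) (Fin 4) ℂ :=
  (1 / 4 : ℂ) • K.map (Int.castRingHom ℂ)

theorem quarter_isHermitian {K : Matrix (Fin 4) (Fin 4) ℤ} (h : K.transpose = K) :
    (quarter K).IsHermitian := by
  ext i j
  have hij : K j i = K i j := congrFun (congrFun h i) j
  simp [quarter, hij]

theorem quarter_mul_self {K : Matrix (Fin 4) (Fin 4) ℤ} (h : K * K = 4 • K) :
    quarter K * quarter K = quarter K := by
  have hmap : K.map (Int.castRingHom ℂ) * K.map (Int.castRingHom ℂ) =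
      (4 : ℂ) • K.map (Int.castRingHom ℂ) := by
    rw [← Matrix.map_mul, h]
    ext i j
    simp [-nsmul_eq_mul, Matrix.smul_apply]
  simp only [quarter, Matrix.smul_mul, Matrix.mul_smul, hmap, smul_smul]
  norm_num

theorem sum_quarter {ι : Type*} [Fintype ι] {K : ι → Matrix (Fin 4) (Fin 4) ℤ}
    (h : ∑ a, K a = 4 • 1) : ∑ a, quarter (K a) = 1 := by
  ext i j
  have hij : ((∑ a, K a i j : ℤ) : ℂ) = 4 * (1 : Matrix (Fin 4) (Fin 4) ℂ) i j := by
    rw [← Matrix.sum_apply, h]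
    by_cases hij : i = j <;> simp [Matrix.one_apply, hij]
  push_cast at hij
  simp only [quarter, Matrix.sum_apply, Matrix.smul_apply, Matrix.map_apply, smul_eq_mul,
    Int.coe_castRingHom, ← Finset.mul_sum, hij]
  ring

theorem posSemidef_of_isHermitian_of_mul_self {n : Type*} [Fintype n] {P : Matrix n n ℂ}
    (hP : P.IsHermitian) (h : P * P = P) : P.PosSemidef := by
  have key := Matrix.posSemidef_conjTranspose_mul_self P
  rwa [hP.eq, h] at key

/-- The correlation of two scaled integer matrices in the state of two EPR pairs. -/
theorem sum_epr_quarter (K L : Matrix (Fin 4) (Fin 4) ℤ) :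
    (∑ i, ∑ j, ∑ k, ∑ l, star (if i = k then (1 / 2 : ℂ) else 0) * quarter K i j * quarter L k l *
      (if j = l then (1 / 2 : ℂ) else 0)) = (1 / 64) * ((∑ i, ∑ j, K i j * L i j : ℤ) : ℂ) := by
  push_cast
  simp only [Finset.mul_sum]
  refine Finset.sum_congr rfl fun i _ => Finset.sum_congr rfl fun j _ => ?_
  simp [quarter, apply_ite, ite_mul]
  ring

end MagicSquare

open MagicSquare

/-- Mermin's perfect quantum strategy for the magic square game: with
`d_A = d_B = 4`, shared state two EPR pairs (the maximally entangled state
`(1/2) ∑ᵢ |ii⟩` on `ℂ⁴ ⊗ ℂ⁴`) and projective measurements on each side, for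
every question pair `(x, y)` the answers satisfy with probability 1 that
Alice's row has even parity, Bob's column has odd parity, and the intersection
entries agree. -/
theorem magic_square_perfect_quantum_strategy :
    ∃ (M : Fin 3 → (Fin 3 → Bool) → Matrix (Fin 4) (Fin 4) ℂ)
      (N : Fin 3 → (Fin 3 → Bool) → Matrix (Fin 4) (Fin 4) ℂ),
      (∀ x a, (M x a).PosSemidef) ∧
      (∀ x, ∑ a, M x a = 1) ∧
      (∀ x a, (M x a).IsHermitian ∧ M x a * M x a = M x a) ∧
      (∀ y b, (N y b).PosSemidef) ∧
      (∀ y, ∑ b, N y b = 1) ∧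
      (∀ y b, (N y b).IsHermitian ∧ N y b * N y b = N y b) ∧
      (let ψ : Fin 4 → Fin 4 → ℂ := fun i k => if i = k then (1 / 2 : ℂ) else 0
      ∀ x y : Fin 3,
        (∑ a : Fin 3 → Bool, ∑ b : Fin 3 → Bool,
          (if xor (a 0) (xor (a 1) (a 2)) = false ∧
              xor (b 0) (xor (b 1) (b 2)) = true ∧ a y = b x then
            ∑ i, ∑ j, ∑ k, ∑ l, star (ψ i k) * M x a i j * N y b k l * ψ j l
          else 0)) = 1) := by
  have hrow x a := quarter_isHermitian (scaledRow_transpose x a)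
  have hrow' x a := quarter_mul_self (scaledRow_mul_self x a)
  have hcol y b := quarter_isHermitian (scaledColumn_transpose y b)
  have hcol' y b := quarter_mul_self (scaledColumn_mul_self y b)
  refine ⟨fun x a => quarter (scaledRow x a), fun y b => quarter (scaledColumn y b),
    fun x a => posSemidef_of_isHermitian_of_mul_self (hrow x a) (hrow' x a),
    fun x => sum_quarter (sum_scaledRow x), fun x a => ⟨hrow x a, hrow' x a⟩,
    fun y b => posSemidef_of_isHermitian_of_mul_self (hcol y b) (hcol' y b),
    fun y => sum_quarter (sum_scaledColumn y), fun y b => ⟨hcol y b, hcol' y b⟩, ?_⟩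
  intro ψ x y
  have hwin := congrArg (fun n : ℤ => (1 / 64 : ℂ) * (n : ℂ)) (sum_winning_scaled x y)
  simp only [ψ, sum_epr_quarter]
  calc
    _ = _ := ?_
    _ = _ := hwin
    _ = 1 := by norm_num
  simp only [Int.cast_sum (s := (Finset.univ : Finset (Fin 3 → Bool))), Finset.mul_sum,
    apply_ite (Int.cast : ℤ → ℂ), mul_ite, Int.cast_zero, mul_zero]
end
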